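/- arXiv:1707.07533 — 3 statements merged into one kernel-verified Lean document; each statement's English description precedes it below -/
import Mathlib

section
/- (Decoupling into the vortex-wave system, Theorem 3.) Let γ>0, let p>2, let ρ∈C_w(ℝ₊,M₊(ℝ²)) with ρ∈L^∞_loc(ℝ₊,L^p(ℝ²))∩L^∞_loc(ℝ₊,L¹(ℝ²)), and let ξ∈C¹(ℝ₊,ℝ²). Assume that for every Φ∈C_c^∞(ℝ₊×ℝ²) the identity d/dt ∫_{ℝ²}Φ(t,x)d(ρ(t)+γδ_{ξ(t)})(x) = ∫_{ℝ²}∂_tΦ(t,x)d(ρ(t)+γδ_{ξ(t)})(x) + H_{Φ(t,·)}[ρ(t)+γδ_{ξ(t)},ρ(t)+γδ_{ξ(t)}] holds in the sense of distributions on ℝ₊ (i.e. equation (E) holds with vanishing defect measure). Then, with E(t,·)=(x/|x|²)∗ρ(t): (i) ρ satisfies the transport equation ∂_tρ+(E^⊥+γ(x−ξ)^⊥/|x−ξ|²)·∇ρ=0 in the sense of distributions on (0,∞)×ℝ², and (ii) ξ̇(t)=E^⊥(t,ξ(t)) for all t. -/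
open MeasureTheory Real Filter
open scoped RealInnerProductSpace ENNReal Topology Classical

noncomputable section

/-- The plane `ℝ²`. -/
abbrev E2 : Type := EuclideanSpace ℝ (Fin 2)

/-- The rotation by π/2: `(x₁,x₂)^⊥ = (-x₂,x₁)`. -/
def perp (x : E2) : E2 := !₂[-(x 1), x 0]

/-- The symmetrized kernel `H_Φ`. -/
def Hker (Φ : E2 → ℝ) (x y : E2) : ℝ :=
  if x = y then 0 else ⟪perp (x - y), gradient Φ x - gradient Φ y⟫ / ‖x - y‖ ^ 2

/-- The symmetrized bilinear form `H_Φ[ρ,μ]`. -/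
def Hform (Φ : E2 → ℝ) (ρ μ : Measure E2) : ℝ :=
  (1 / 2) * ∫ x, (∫ y, Hker Φ x y ∂μ) ∂ρ

/-- Entry `(i,j)` of the Jacobian matrix `D∇^⊥Φ` of `∇^⊥Φ = (-∂₂Φ, ∂₁Φ)`. -/
def DperpGrad (Φ : E2 → ℝ) (i j : Fin 2) (x : E2) : ℝ :=
  fderiv ℝ (fun y => perp (gradient Φ y) i) x (EuclideanSpace.single j 1)


theorem perp_apply (x : E2) : perp x = !₂[-(x 1), x 0] := rfl

theorem norm_perp (x : E2) : ‖perp x‖ = ‖x‖ := by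
  simp [perp, EuclideanSpace.norm_eq, Fin.sum_univ_two, add_comm]

/-- The rotation as a continuous linear map. -/
def perpL : E2 →L[ℝ] E2 :=
  LinearMap.toContinuousLinearMap
    { toFun := perp
      map_add' := by
        intro x y; ext i; fin_cases i <;> simp [perp] <;> ring
      map_smul' := by
        intro c x; ext i; fin_cases i <;> simp [perp] }

theorem perpL_apply (x : E2) : perpL x = perp x := rfl

/-- The rotated kernel. -/
def Kv (z : E2) : E2 := (‖z‖ ^ 2)⁻¹ • perp z

theorem norm_Kv (z : E2) : ‖Kv z‖ = ‖z‖⁻¹ := by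
  rw [Kv, norm_smul, norm_perp]
  by_cases h : ‖z‖ = 0
  · simp [h]
  · simp; field_simp

theorem Kv_neg (z : E2) : Kv (-z) = - Kv z := by
  simp only [Kv, norm_neg, ← perpL_apply, map_neg, smul_neg]

theorem Kv_zero : Kv 0 = 0 := by
  simp [Kv]

theorem measurable_Kv : Measurable Kv := by
  have h1 : Measurable fun z : E2 => (‖z‖ ^ 2)⁻¹ := by fun_prop
  have h2 : Measurable fun z : E2 => perp z := perpL.continuous.measurable
  exact h1.smul h2

theorem Hker_eq (φ : E2 → ℝ) (x y : E2) :
    Hker φ x y = ⟪Kv (x - y), gradient φ x - gradient φ y⟫ := by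
  unfold Hker
  split_ifs with h
  · simp [h]
  · rw [Kv, real_inner_smul_left]; ring

theorem sing_lt_top (q : ℝ) (hq0 : 0 < q) (hq : q < 2) :
    ∫⁻ z in Metric.ball (0 : E2) 1, (ENNReal.ofReal ‖z‖⁻¹) ^ q ≠ ∞ := by
  have h : IntegrableOn (fun z : E2 => ‖z‖ ^ (-q)) (Metric.ball 0 1) volume := by
    apply integrableOn_ball_of_norm_le_rpow (C := 1) (α := q)
    · simpa using hq
    · refine Eventually.of_forall fun x => ?_
      rw [Real.norm_of_nonneg (by positivity), one_mul]
    · exact (by fun_prop : Measurable fun z : E2 => ‖z‖ ^ (-q)).aestronglyMeasurable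
    · simp
  have h2 := h.2
  have h3 : ∀ z : E2, (ENNReal.ofReal ‖z‖⁻¹) ^ q = ‖(‖z‖ ^ (-q))‖ₑ := by
    intro z
    rw [ENNReal.ofReal_rpow_of_nonneg (by positivity) hq0.le, Real.enorm_of_nonneg (by positivity),
      Real.inv_rpow (by positivity), Real.rpow_neg (by positivity)]
  simp_rw [h3]
  exact h2.ne

theorem holder_small (p C η : ℝ) (hp : 2 < p) (hη : 0 < η) :
    ∃ r : ℝ, 0 < r ∧ r ≤ 1 ∧ ∀ f : E2 → ℝ, Measurable f → (∀ y, 0 ≤ f y) →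
      eLpNorm f (ENNReal.ofReal p) volume ≤ ENNReal.ofReal C → ∀ x : E2,
      ∫⁻ y in Metric.ball x r, ENNReal.ofReal (f y * ‖x - y‖⁻¹) ≤ ENNReal.ofReal η := by
  set q := p.conjExponent with hqdef
  have hpq : p.HolderConjugate q := Real.HolderConjugate.conjExponent (by linarith)
  have hq0 : 0 < q := hpq.symm.pos
  have hq2 : q < 2 := by
    rw [hqdef, Real.conjExponent, div_lt_iff₀] <;> linarith
  set g : E2 → ℝ≥0∞ := fun z => (ENNReal.ofReal ‖z‖⁻¹) with hg
  have hgm : Measurable g := by fun_prop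
  set I : ℝ → ℝ≥0∞ := fun r => ∫⁻ z in Metric.ball (0 : E2) r, g z ^ q with hI
  have hItend : Tendsto I (𝓝[>] 0) (𝓝 0) := by
    have h1 : Tendsto (fun r : ℝ => (volume.restrict (Metric.ball (0:E2) 1)) (Metric.ball (0:E2) r))
        (𝓝[>] 0) (𝓝 0) := by
      have h2 : Tendsto (fun r : ℝ => ENNReal.ofReal (r ^ 2) * volume (Metric.ball (0:E2) 1))
          (𝓝[>] 0) (𝓝 0) := by
        have : Tendsto (fun r : ℝ => ENNReal.ofReal (r ^ 2)) (𝓝[>] 0) (𝓝 0) := by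
          have h3 : Continuous fun r : ℝ => ENNReal.ofReal (r ^ 2) :=
            ENNReal.continuous_ofReal.comp (by fun_prop)
          have := h3.tendsto 0
          simp only [ne_eq, OfNat.ofNat_ne_zero, not_false_eq_true, zero_pow,
            ENNReal.ofReal_zero] at this
          exact this.mono_left nhdsWithin_le_nhds
        have h4 := ENNReal.Tendsto.mul_const (b := volume (Metric.ball (0:E2) 1)) this
          (Or.inr measure_ball_lt_top.ne)
        simpa using h4
      refine tendsto_of_tendsto_of_tendsto_of_le_of_le' tendsto_const_nhds h2
        (Eventually.of_forall fun _ => zero_le) ?_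
      filter_upwards [self_mem_nhdsWithin] with r hr
      refine (Measure.restrict_apply_le _ _).trans ?_
      rw [Measure.addHaar_ball _ _ (le_of_lt hr)]
      simp
    have h5 := tendsto_setLIntegral_zero (sing_lt_top q hq0 hq2) h1
    refine h5.congr' ?_
    have : ∀ᶠ r : ℝ in 𝓝[>] 0, r < 1 := by
      apply mem_nhdsWithin_of_mem_nhds
      exact Iio_mem_nhds one_pos
    filter_upwards [this] with r hr
    simp only [hI, hg]
    rw [Measure.restrict_restrict measurableSet_ball,
      Set.inter_eq_left.2 (Metric.ball_subset_ball hr.le)]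
  have hT : Tendsto (fun r => ENNReal.ofReal C * (I r) ^ (1 / q)) (𝓝[>] 0) (𝓝 0) := by
    have h1 := (ENNReal.continuous_rpow_const (y := 1 / q)).tendsto 0 |>.comp hItend
    have h2 := ENNReal.Tendsto.const_mul (a := ENNReal.ofReal C) h1 (Or.inr ENNReal.ofReal_ne_top)
    have h3 : (0 : ℝ≥0∞) ^ (1 / q) = 0 := ENNReal.zero_rpow_of_pos (by positivity)
    rw [h3, mul_zero] at h2
    exact h2
  have hev : ∀ᶠ r in 𝓝[>] (0:ℝ), ENNReal.ofReal C * (I r) ^ (1 / q) ≤ ENNReal.ofReal η :=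
    hT.eventually (ge_mem_nhds (by simpa using hη))
  have hle1 : ∀ᶠ r : ℝ in 𝓝[>] 0, r ≤ 1 := by
    apply mem_nhdsWithin_of_mem_nhds
    exact Iic_mem_nhds one_pos
  obtain ⟨r, ⟨h1, h2⟩, h3⟩ := ((hev.and hle1).and self_mem_nhdsWithin).exists
  refine ⟨r, h3, h2, ?_⟩
  intro f hf hf0 hfp x
  set h : E2 → ℝ≥0∞ := (Metric.ball (0:E2) r).indicator g with hh
  have hhm : Measurable h := hgm.indicator measurableSet_ball
  calc ∫⁻ y in Metric.ball x r, ENNReal.ofReal (f y * ‖x - y‖⁻¹)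
      = ∫⁻ y, ((fun y => ENNReal.ofReal (f y)) * fun y => h (x - y)) y := by
        rw [← lintegral_indicator measurableSet_ball]
        congr 1; ext y
        simp only [hh, hg, Set.indicator, Pi.mul_apply, Metric.mem_ball, dist_zero_right]
        rw [dist_comm, dist_eq_norm]
        split_ifs
        · rw [ENNReal.ofReal_mul (hf0 y)]
        · simp
    _ ≤ (∫⁻ y, ENNReal.ofReal (f y) ^ p) ^ (1 / p) * (∫⁻ y, h (x - y) ^ q) ^ (1 / q) :=
        ENNReal.lintegral_mul_le_Lp_mul_Lq _ hpq (by fun_prop)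
          (hhm.comp (by fun_prop)).aemeasurable
    _ = eLpNorm f (ENNReal.ofReal p) volume * (I r) ^ (1 / q) := by
        congr 1
        · rw [eLpNorm_eq_lintegral_rpow_enorm_toReal (by simp; linarith) ENNReal.ofReal_ne_top,
            ENNReal.toReal_ofReal (by linarith)]
          simp_rw [fun y => Real.enorm_of_nonneg (hf0 y)]
        · congr 1
          rw [lintegral_sub_left_eq_self (fun z => h z ^ q) x]
          simp only [hI]
          rw [← lintegral_indicator measurableSet_ball]
          congr 1; ext y
          simp only [hh, Set.indicator]
          split_ifs
          · rfl
          · exact ENNReal.zero_rpow_of_pos hq0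
    _ ≤ ENNReal.ofReal C * (I r) ^ (1 / q) := by gcongr
    _ ≤ ENNReal.ofReal η := h1


/-- Densities with uniformly bounded Riesz potential. -/
structure Good (f : E2 → ℝ) (M : ℝ) : Prop where
  meas : Measurable f
  nn : ∀ y, 0 ≤ f y
  int : Integrable f
  mass : ∫ y, f y ≤ M
  kint : ∀ x, Integrable fun y => f y * ‖x - y‖⁻¹
  kbd : ∀ x, ∫ y, f y * ‖x - y‖⁻¹ ≤ M

theorem good_of (p C : ℝ) (hp : 2 < p) : ∃ M : ℝ, 0 ≤ M ∧ ∀ f : E2 → ℝ, Measurable f →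
    (∀ y, 0 ≤ f y) → Integrable f → eLpNorm f (ENNReal.ofReal p) volume ≤ ENNReal.ofReal C →
    ∫ y, f y ≤ C → Good f M := by
  obtain ⟨r, hr0, hr1, H⟩ := holder_small p C 1 hp one_pos
  refine ⟨1 + |C| / r + |C|, by positivity, ?_⟩
  intro f hm hn hi hlp hC
  have hmass : ∫ y, f y ≤ |C| := hC.trans (le_abs_self _)
  have hq : ∀ x : E2, MeasurableSet (Metric.ball x r) := fun x => measurableSet_ball
  have hmm : ∀ x : E2, Measurable fun y => f y * ‖x - y‖⁻¹ := fun x => by fun_prop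
  have hnn : ∀ x y : E2, 0 ≤ f y * ‖x - y‖⁻¹ := fun x y => mul_nonneg (hn y) (by positivity)
  have h1 : ∀ x, IntegrableOn (fun y => f y * ‖x - y‖⁻¹) (Metric.ball x r) := by
    intro x
    refine ⟨(hmm x).aestronglyMeasurable, ?_⟩
    rw [hasFiniteIntegral_iff_ofReal (Eventually.of_forall (hnn x))]
    exact (H f hm hn hlp x).trans_lt ENNReal.ofReal_lt_top
  have hb : ∀ x : E2, ∀ y ∈ (Metric.ball x r)ᶜ, f y * ‖x - y‖⁻¹ ≤ f y * r⁻¹ := by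
    intro x y hy
    have : r ≤ ‖x - y‖ := by
      simpa [Metric.mem_ball, dist_comm, dist_eq_norm] using hy
    exact mul_le_mul_of_nonneg_left (inv_anti₀ hr0 this) (hn y)
  have h2 : ∀ x, IntegrableOn (fun y => f y * ‖x - y‖⁻¹) (Metric.ball x r)ᶜ := by
    intro x
    refine Integrable.mono' (hi.mul_const r⁻¹).integrableOn (hmm x).aestronglyMeasurable ?_
    filter_upwards [ae_restrict_mem (hq x).compl] with y hy
    rw [Real.norm_of_nonneg (hnn x y)]
    exact hb x y hy
  have h3 : ∀ x, Integrable fun y => f y * ‖x - y‖⁻¹ := by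
    intro x
    rw [← integrableOn_univ, ← Set.union_compl_self (Metric.ball x r)]
    exact (h1 x).union (h2 x)
  refine ⟨hm, hn, hi, ?_, h3, ?_⟩
  · have : 0 ≤ |C| / r := by positivity
    linarith
  · intro x
    rw [← integral_add_compl (hq x) (h3 x)]
    have e1 : ∫ y in Metric.ball x r, f y * ‖x - y‖⁻¹ ≤ 1 := by
      rw [integral_eq_lintegral_of_nonneg_ae (Eventually.of_forall (hnn x))
        (hmm x).aestronglyMeasurable]
      refine ENNReal.toReal_le_of_le_ofReal zero_le_one (H f hm hn hlp x)
    have e2 : ∫ y in (Metric.ball x r)ᶜ, f y * ‖x - y‖⁻¹ ≤ |C| / r := by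
      calc ∫ y in (Metric.ball x r)ᶜ, f y * ‖x - y‖⁻¹
          ≤ ∫ y in (Metric.ball x r)ᶜ, f y * r⁻¹ :=
            setIntegral_mono_on (h2 x) (hi.mul_const r⁻¹).integrableOn (hq x).compl (hb x)
        _ ≤ ∫ y, f y * r⁻¹ := setIntegral_le_integral (hi.mul_const r⁻¹)
            (Eventually.of_forall fun y => mul_nonneg (hn y) (by positivity))
        _ = (∫ y, f y) * r⁻¹ := integral_mul_const _ _
        _ ≤ |C| / r := by rw [div_eq_mul_inv]; gcongr
    have : 0 ≤ |C| := abs_nonneg _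
    linarith

theorem near_small (p C η : ℝ) (hp : 2 < p) (hη : 0 < η) : ∃ r : ℝ, 0 < r ∧ r ≤ 1 ∧
    ∀ f : E2 → ℝ, Measurable f →
    (∀ y, 0 ≤ f y) → eLpNorm f (ENNReal.ofReal p) volume ≤ ENNReal.ofReal C →
    ∀ x, ∫ y in Metric.ball x r, f y * ‖x - y‖⁻¹ ≤ η := by
  obtain ⟨r, hr0, hr1, H⟩ := holder_small p C η hp hη
  refine ⟨r, hr0, hr1, ?_⟩
  intro f hm hn hlp x
  have hmm : ∀ x : E2, Measurable fun y => f y * ‖x - y‖⁻¹ := fun x => by fun_prop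
  rw [integral_eq_lintegral_of_nonneg_ae (Eventually.of_forall fun y => mul_nonneg (hn y)
    (by positivity)) (hmm x).aestronglyMeasurable]
  exact ENNReal.toReal_le_of_le_ofReal hη.le (H f hm hn hlp x)

/-- The rotated field generated by `f`. -/
def Ep (f : E2 → ℝ) (x : E2) : E2 := ∫ y, f y • Kv (x - y)

theorem Good.Kint {f : E2 → ℝ} {M : ℝ} (h : Good f M) (x : E2) :
    Integrable fun y => f y • Kv (x - y) := by
  have hm : Measurable fun y => f y • Kv (x - y) :=
    h.meas.smul (measurable_Kv.comp (by fun_prop))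
  refine (h.kint x).mono' hm.aestronglyMeasurable (Eventually.of_forall fun y => ?_)
  rw [norm_smul, norm_Kv, Real.norm_of_nonneg (h.nn y)]

theorem Good.Ep_bd {f : E2 → ℝ} {M : ℝ} (h : Good f M) (x : E2) : ‖Ep f x‖ ≤ M := by
  refine (norm_integral_le_integral_norm _).trans ?_
  simp_rw [norm_smul, norm_Kv, fun y => Real.norm_of_nonneg (h.nn y)]
  exact h.kbd x

theorem Good.Ep_eq {f : E2 → ℝ} {M : ℝ} (h : Good f M) (x : E2) :
    perp (∫ y, f y • ((‖x - y‖ ^ 2)⁻¹ • (x - y))) = Ep f x := by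
  have hm : Measurable fun y : E2 => f y • ((‖x - y‖ ^ 2)⁻¹ • (x - y)) := by
    have h1 : Measurable fun y : E2 => (‖x - y‖ ^ 2)⁻¹ := by fun_prop
    have h2 : Measurable fun y : E2 => x - y := by fun_prop
    exact h.meas.smul (h1.smul h2)
  have hi : Integrable fun y => f y • ((‖x - y‖ ^ 2)⁻¹ • (x - y)) := by
    refine (h.Kint x).mono hm.aestronglyMeasurable (Eventually.of_forall fun y => ?_)
    simp only [Kv, norm_smul, norm_perp, le_refl]
  rw [← perpL_apply, ← ContinuousLinearMap.integral_comp_comm _ hi]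
  simp only [Ep, Kv, map_smul, perpL_apply]

theorem measurable_Ep {f : E2 → ℝ} (h : Measurable f) : StronglyMeasurable (Ep f) := by
  have : Measurable (Function.uncurry fun x y : E2 => f y • Kv (x - y)) := by
    exact (h.comp measurable_snd).smul (measurable_Kv.comp (measurable_fst.sub measurable_snd))
  exact this.stronglyMeasurable.integral_prod_right

/-- The total measure. -/
def mu (f : E2 → ℝ) (γ : ℝ) (a : E2) : Measure E2 :=
  (volume.withDensity fun x => ENNReal.ofReal (f x)) + ENNReal.ofReal γ • Measure.dirac a

theorem integral_mu {f : E2 → ℝ} {γ : ℝ} {a : E2} (hm : Measurable f) (hn : ∀ y, 0 ≤ f y)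
    (hγ : 0 < γ) (g : E2 → ℝ) (hg : Integrable fun x => g x * f x) :
    ∫ x, g x ∂(mu f γ a) = (∫ x, g x * f x) + γ * g a := by
  have hm' : Measurable fun x => ENNReal.ofReal (f x) := by fun_prop
  have hlt : ∀ᵐ x, ENNReal.ofReal (f x) < ∞ := Eventually.of_forall fun x => ENNReal.ofReal_lt_top
  have e : ∀ x, (ENNReal.ofReal (f x)).toReal • g x = g x * f x := fun x => by
    rw [ENNReal.toReal_ofReal (hn x), smul_eq_mul, mul_comm]
  rw [mu, integral_add_measure, integral_smul_measure, integral_dirac,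
    integral_withDensity_eq_integral_toReal_smul hm' hlt, ENNReal.toReal_ofReal hγ.le]
  · simp_rw [e]; simp
  · rw [integrable_withDensity_iff_integrable_smul' hm' hlt]
    simp_rw [e]; exact hg
  · exact (integrable_dirac (by simp)).smul_measure ENNReal.ofReal_ne_top

theorem Hform_eq {f : E2 → ℝ} {M γ C : ℝ} {a : E2} (h : Good f M) (hγ : 0 < γ)
    (φ : E2 → ℝ) (hc : Continuous (gradient φ)) (hC : ∀ x, ‖gradient φ x‖ ≤ C) :
    Hform φ (mu f γ a) (mu f γ a) =
      (∫ x, ⟪Ep f x + γ • Kv (x - a), gradient φ x⟫ * f x) + γ * ⟪Ep f a, gradient φ a⟫ := by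
  set G := gradient φ with hG
  have hC0 : 0 ≤ C := (norm_nonneg _).trans (hC 0)
  have hKm : Measurable fun q : E2 × E2 => Kv (q.1 - q.2) :=
    measurable_Kv.comp (measurable_fst.sub measurable_snd)
  have hKm' : ∀ b : E2, Measurable fun x => Kv (x - b) := fun b =>
    measurable_Kv.comp (by fun_prop)
  have hKm'' : ∀ b : E2, Measurable fun x => Kv (b - x) := fun b =>
    measurable_Kv.comp (by fun_prop)
  have hGm : Measurable G := hc.measurable
  -- first piece
  have i1 : ∀ x, Integrable fun y => ⟪Kv (x - y), G x⟫ * f y := by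
    intro x
    refine ((h.kint x).mul_const C).mono'
      (((hKm'' x).inner measurable_const).mul h.meas).aestronglyMeasurable
      (Eventually.of_forall fun y => ?_)
    rw [norm_mul, Real.norm_of_nonneg (h.nn y)]
    have := (norm_inner_le_norm (𝕜 := ℝ) (Kv (x - y)) (G x))
    rw [norm_Kv] at this
    have h2 : ‖x - y‖⁻¹ * ‖G x‖ ≤ ‖x - y‖⁻¹ * C := by gcongr; exact hC x
    calc _ ≤ (‖x - y‖⁻¹ * C) * f y := by
          refine mul_le_mul_of_nonneg_right (this.trans h2) (h.nn y)
      _ = _ := by ring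
  have i2 : ∀ x, Integrable fun y => ⟪Kv (x - y), G y⟫ * f y := by
    intro x
    refine ((h.kint x).mul_const C).mono'
      (((hKm'' x).inner hGm).mul h.meas).aestronglyMeasurable
      (Eventually.of_forall fun y => ?_)
    rw [norm_mul, Real.norm_of_nonneg (h.nn y)]
    have := (norm_inner_le_norm (𝕜 := ℝ) (Kv (x - y)) (G y))
    rw [norm_Kv] at this
    have h2 : ‖x - y‖⁻¹ * ‖G y‖ ≤ ‖x - y‖⁻¹ * C := by gcongr; exact hC y
    calc _ ≤ (‖x - y‖⁻¹ * C) * f y := by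
          refine mul_le_mul_of_nonneg_right (this.trans h2) (h.nn y)
      _ = _ := by ring
  have v1 : ∀ x, ∫ y, ⟪Kv (x - y), G x⟫ * f y = ⟪Ep f x, G x⟫ := by
    intro x
    rw [real_inner_comm, Ep, ← integral_inner (h.Kint x)]
    congr 1; ext y
    rw [real_inner_smul_right, real_inner_comm, mul_comm]
  set J : E2 → ℝ := fun x => ∫ y, ⟪Kv (x - y), G y⟫ * f y with hJ
  have hH : ∀ x y, Hker φ x y = ⟪Kv (x - y), G x⟫ - ⟪Kv (x - y), G y⟫ := by
    intro x y; rw [Hker_eq, inner_sub_right]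
  have hHint : ∀ x, Integrable fun y => Hker φ x y * f y := by
    intro x
    have := (i1 x).sub (i2 x)
    refine this.congr (Eventually.of_forall fun y => ?_)
    simp only [Pi.sub_apply, hH]; ring
  have hHv : ∀ x, ∫ y, Hker φ x y * f y = ⟪Ep f x, G x⟫ - J x := by
    intro x
    simp_rw [hH, sub_mul]
    rw [integral_sub (i1 x) (i2 x), v1 x]
  have inner_eq : ∀ x, ∫ y, Hker φ x y ∂(mu f γ a) =
      ⟪Ep f x, G x⟫ - J x + γ * Hker φ x a := by
    intro x
    rw [integral_mu h.meas h.nn hγ _ (hHint x), hHv]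
  -- Fubini
  have hJm : StronglyMeasurable J := by
    have : Measurable (Function.uncurry fun x y : E2 => ⟪Kv (x - y), G y⟫ * f y) :=
      (hKm.inner (hGm.comp measurable_snd)).mul (h.meas.comp measurable_snd)
    exact this.stronglyMeasurable.integral_prod_right
  have hJbd : ∀ x, ‖J x‖ ≤ M * C := by
    intro x
    refine (norm_integral_le_of_norm_le ((h.kint x).mul_const C)
      (Eventually.of_forall fun y => ?_)).trans ?_
    · rw [norm_mul, Real.norm_of_nonneg (h.nn y)]
      have := (norm_inner_le_norm (𝕜 := ℝ) (Kv (x - y)) (G y))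
      rw [norm_Kv] at this
      have h2 : ‖x - y‖⁻¹ * ‖G y‖ ≤ ‖x - y‖⁻¹ * C := by gcongr; exact hC y
      calc _ ≤ (‖x - y‖⁻¹ * C) * f y := by
            refine mul_le_mul_of_nonneg_right (this.trans h2) (h.nn y)
        _ = _ := by ring
    · rw [integral_mul_const]
      exact mul_le_mul_of_nonneg_right (h.kbd x) hC0
  have hEm := measurable_Ep h.meas
  have hEbd : ∀ x, ‖⟪Ep f x, G x⟫‖ ≤ M * C := fun x =>
    (norm_inner_le_norm (𝕜 := ℝ) _ _).trans
      (mul_le_mul (h.Ep_bd x) (hC x) (norm_nonneg _) ((norm_nonneg _).trans (h.Ep_bd x)))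
  have iJ : Integrable fun x => J x * f x :=
    h.int.bdd_mul hJm.aestronglyMeasurable (Eventually.of_forall hJbd)
  have iE : Integrable fun x => ⟪Ep f x, G x⟫ * f x :=
    h.int.bdd_mul (hEm.measurable.inner hGm).aestronglyMeasurable (Eventually.of_forall hEbd)
  have ia1 : Integrable fun x => ⟪Kv (x - a), G x⟫ * f x := by
    refine (i2 a).neg.congr (Eventually.of_forall fun y => ?_)
    simp only [Pi.neg_apply]
    rw [← neg_sub y a, Kv_neg, inner_neg_left]; ring
  have ia2 : Integrable fun x => ⟪Kv (x - a), G a⟫ * f x := by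
    refine (i1 a).neg.congr (Eventually.of_forall fun y => ?_)
    simp only [Pi.neg_apply]
    rw [← neg_sub y a, Kv_neg, inner_neg_left]; ring
  have hsymm : ∀ x y, Hker φ x y = Hker φ y x := by
    intro x y
    rw [hH, hH, ← neg_sub y x, Kv_neg, inner_neg_left, inner_neg_left]; ring
  have iHa : Integrable fun x => Hker φ x a * f x := by
    refine (hHint a).congr (Eventually.of_forall fun y => ?_)
    simp only; rw [hsymm]
  have vHa : ∫ x, Hker φ x a * f x = (∫ x, ⟪Kv (x - a), G x⟫ * f x) + ⟪Ep f a, G a⟫ := by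
    have e : ∫ x, ⟪Kv (x - a), G a⟫ * f x = - ⟪Ep f a, G a⟫ := by
      rw [← v1 a, ← integral_neg]
      congr 1; ext y
      rw [← neg_sub y a, Kv_neg, inner_neg_left]; ring
    simp_rw [hH, sub_mul]
    rw [integral_sub ia1 ia2, e]; ring
  have hHaa : Hker φ a a = 0 := by simp [Hker]
  have fub : ∫ x, J x * f x = - ∫ x, ⟪Ep f x, G x⟫ * f x := by
    have hint : Integrable (Function.uncurry fun x y : E2 => ⟪Kv (x - y), G y⟫ * f y * f x)
        (volume.prod volume) := by
      have hms : Measurable (Function.uncurry fun x y : E2 => ⟪Kv (x - y), G y⟫ * f y * f x) :=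
        ((hKm.inner (hGm.comp measurable_snd)).mul (h.meas.comp measurable_snd)).mul
          (h.meas.comp measurable_fst)
      rw [integrable_prod_iff hms.aestronglyMeasurable]
      refine ⟨Eventually.of_forall fun x => (i2 x).mul_const (f x), ?_⟩
      refine (h.int.const_mul (M * C)).mono'
        hms.stronglyMeasurable.norm.integral_prod_right'.aestronglyMeasurable
        (Eventually.of_forall fun x => ?_)
      rw [Real.norm_of_nonneg (integral_nonneg fun _ => norm_nonneg _)]
      simp only [Function.uncurry, norm_mul (_ * _) (f x), Real.norm_of_nonneg (h.nn x)]
      rw [integral_mul_const]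
      refine mul_le_mul_of_nonneg_right ?_ (h.nn x)
      have : ∫ y, ‖⟪Kv (x - y), G y⟫ * f y‖ ≤ ∫ y, f y * ‖x - y‖⁻¹ * C := by
        refine integral_mono (i2 x).norm ((h.kint x).mul_const C) fun y => ?_
        simp only
        rw [norm_mul, Real.norm_of_nonneg (h.nn y)]
        have := (norm_inner_le_norm (𝕜 := ℝ) (Kv (x - y)) (G y))
        rw [norm_Kv] at this
        have h2 : ‖x - y‖⁻¹ * ‖G y‖ ≤ ‖x - y‖⁻¹ * C := by gcongr; exact hC y
        calc _ ≤ (‖x - y‖⁻¹ * C) * f y := by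
              refine mul_le_mul_of_nonneg_right (this.trans h2) (h.nn y)
          _ = _ := by ring
      refine this.trans ?_
      rw [integral_mul_const]
      exact mul_le_mul_of_nonneg_right (h.kbd x) hC0
    calc ∫ x, J x * f x = ∫ x, ∫ y, ⟪Kv (x - y), G y⟫ * f y * f x := by
          congr 1; ext x; rw [integral_mul_const]
      _ = ∫ y, ∫ x, ⟪Kv (x - y), G y⟫ * f y * f x := integral_integral_swap hint
      _ = ∫ y, - (⟪Ep f y, G y⟫ * f y) := by
          congr 1; ext y
          rw [← v1 y, ← integral_mul_const, ← integral_neg]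
          congr 1; ext x
          rw [← neg_sub y x, Kv_neg, inner_neg_left]; ring
      _ = _ := by rw [integral_neg]
  unfold Hform
  simp_rw [inner_eq]
  have iAll : Integrable fun x => (⟪Ep f x, G x⟫ - J x + γ * Hker φ x a) * f x := by
    refine ((iE.sub iJ).add (iHa.const_mul γ)).congr (Eventually.of_forall fun x => ?_)
    simp only [Pi.sub_apply, Pi.add_apply]; ring
  rw [integral_mu h.meas h.nn hγ _ iAll]
  have e1 : ∫ x, (⟪Ep f x, G x⟫ - J x + γ * Hker φ x a) * f x =
      (∫ x, ⟪Ep f x, G x⟫ * f x) - (∫ x, J x * f x) + γ * ∫ x, Hker φ x a * f x := by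
    have iS : Integrable fun x => ⟪Ep f x, G x⟫ * f x - J x * f x := iE.sub iJ
    rw [← integral_const_mul, ← integral_sub iE iJ, ← integral_add iS (iHa.const_mul γ)]
    congr 1; ext x; ring
  have e2 : ∫ x, ⟪Ep f x + γ • Kv (x - a), G x⟫ * f x =
      (∫ x, ⟪Ep f x, G x⟫ * f x) + γ * ∫ x, ⟪Kv (x - a), G x⟫ * f x := by
    rw [← integral_const_mul, ← integral_add iE (ia1.const_mul γ)]
    congr 1; ext x; rw [inner_add_left, real_inner_smul_left]; ring
  have e3 : ⟪Ep f a, G a⟫ - J a = (∫ x, ⟪Kv (x - a), G x⟫ * f x) + ⟪Ep f a, G a⟫ := by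
    rw [← hHv a, ← vHa]
    congr 1; ext x; rw [hsymm]
  rw [e1, e2, hHaa, vHa, e3, fub]
  ring


section testfun

variable {Φ : ℝ → E2 → ℝ}

theorem hasFDerivAt_joint (hs : ContDiff ℝ (⊤ : ℕ∞) (fun q : ℝ × E2 => Φ q.1 q.2)) (s : ℝ) (x : E2) :
    HasFDerivAt (fun q : ℝ × E2 => Φ q.1 q.2)
      (fderiv ℝ (fun q : ℝ × E2 => Φ q.1 q.2) (s, x)) (s, x) :=
  ((hs.differentiable (by simp)) (s, x)).hasFDerivAt

theorem hasDerivAt_time (hs : ContDiff ℝ (⊤ : ℕ∞) (fun q : ℝ × E2 => Φ q.1 q.2)) (s : ℝ) (x : E2) :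
    HasDerivAt (fun τ => Φ τ x) (fderiv ℝ (fun q : ℝ × E2 => Φ q.1 q.2) (s, x) (1, 0)) s := by
  have h := (hasFDerivAt_joint hs s x).comp_hasDerivAt s
    ((hasDerivAt_id s).prodMk (hasDerivAt_const s x))
  exact h

theorem hasFDerivAt_space (hs : ContDiff ℝ (⊤ : ℕ∞) (fun q : ℝ × E2 => Φ q.1 q.2)) (s : ℝ)
    (x : E2) :
    HasFDerivAt (Φ s) ((fderiv ℝ (fun q : ℝ × E2 => Φ q.1 q.2) (s, x)).comp
      (ContinuousLinearMap.inr ℝ ℝ E2)) x := by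
  have h := (hasFDerivAt_joint hs s x).comp x
    ((hasFDerivAt_const s x).prodMk (hasFDerivAt_id x))
  exact h

theorem gradient_joint (hs : ContDiff ℝ (⊤ : ℕ∞) (fun q : ℝ × E2 => Φ q.1 q.2)) (s : ℝ) (x : E2) :
    gradient (Φ s) x = (InnerProductSpace.toDual ℝ E2).symm
      ((fderiv ℝ (fun q : ℝ × E2 => Φ q.1 q.2) (s, x)).comp (ContinuousLinearMap.inr ℝ ℝ E2)) := by
  rw [gradient, (hasFDerivAt_space hs s x).fderiv]

theorem continuous_gradient (hs : ContDiff ℝ (⊤ : ℕ∞) (fun q : ℝ × E2 => Φ q.1 q.2)) :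
    Continuous fun q : ℝ × E2 => gradient (Φ q.1) q.2 := by
  have h : Continuous (fderiv ℝ (fun q : ℝ × E2 => Φ q.1 q.2)) := hs.continuous_fderiv (by simp)
  simp_rw [gradient_joint hs]
  refine (LinearIsometryEquiv.continuous _).comp ?_
  exact h.clm_comp continuous_const

theorem continuous_dt (hs : ContDiff ℝ (⊤ : ℕ∞) (fun q : ℝ × E2 => Φ q.1 q.2)) :
    Continuous fun q : ℝ × E2 => deriv (fun τ => Φ τ q.2) q.1 := by
  have h : Continuous (fderiv ℝ (fun q : ℝ × E2 => Φ q.1 q.2)) := hs.continuous_fderiv (by simp)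
  simp_rw [fun q : ℝ × E2 => (hasDerivAt_time hs q.1 q.2).deriv]
  exact h.clm_apply continuous_const

theorem bounds_test (hs : ContDiff ℝ (⊤ : ℕ∞) (fun q : ℝ × E2 => Φ q.1 q.2))
    (hc : HasCompactSupport (fun q : ℝ × E2 => Φ q.1 q.2)) :
    ∃ C : ℝ, 0 ≤ C ∧ (∀ s x, ‖gradient (Φ s) x‖ ≤ C) ∧ (∀ s x, |deriv (fun τ => Φ τ x) s| ≤ C) ∧
      (∀ s x, |Φ s x| ≤ C) := by
  have h : Continuous (fderiv ℝ (fun q : ℝ × E2 => Φ q.1 q.2)) := hs.continuous_fderiv (by simp)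
  obtain ⟨C, hC⟩ := h.bounded_above_of_compact_support (hc.fderiv (𝕜 := ℝ))
  obtain ⟨C', hC'⟩ := hs.continuous.bounded_above_of_compact_support hc
  have hC0 : 0 ≤ C := (norm_nonneg _).trans (hC 0)
  refine ⟨max C C', hC0.trans (le_max_left _ _), fun s x => ?_, fun s x => ?_, fun s x => ?_⟩
  · rw [gradient_joint hs, LinearIsometryEquiv.norm_map]
    refine le_trans ?_ (le_max_left _ _)
    refine ContinuousLinearMap.opNorm_le_bound _ hC0 fun v => ?_
    simp only [ContinuousLinearMap.comp_apply, ContinuousLinearMap.inr_apply]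
    refine (ContinuousLinearMap.le_of_opNorm_le _ (hC (s, x)) _).trans ?_
    simp
  · rw [(hasDerivAt_time hs s x).deriv]
    refine le_trans ?_ (le_max_left _ _)
    have := (ContinuousLinearMap.le_of_opNorm_le _ (hC (s, x)) (1, 0))
    simpa using this
  · exact (hC' (s, x)).trans (le_max_right _ _)

theorem hasDerivAt_along (hs : ContDiff ℝ (⊤ : ℕ∞) (fun q : ℝ × E2 => Φ q.1 q.2))
    {c : ℝ → E2} {c' : E2} {s : ℝ} (h : HasDerivAt c c' s) :
    HasDerivAt (fun s => Φ s (c s))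
      (deriv (fun τ => Φ τ (c s)) s + ⟪c', gradient (Φ s) (c s)⟫) s := by
  have h1 := (hasFDerivAt_joint hs s (c s)).comp_hasDerivAt s ((hasDerivAt_id s).prodMk h)
  refine h1.congr_deriv ?_
  rw [(hasDerivAt_time hs s (c s)).deriv, gradient_joint hs, real_inner_comm,
    InnerProductSpace.toDual_symm_apply]
  simp only [ContinuousLinearMap.comp_apply, ContinuousLinearMap.inr_apply]
  rw [← map_add]
  simp

end testfun

/-- All the hypotheses on the system. -/
structure Sys (γ p : ℝ) (u : ℝ → E2 → ℝ) (ξ : ℝ → E2) : Prop where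
  hγ : 0 < γ
  hp : 2 < p
  humeas : Measurable (Function.uncurry u)
  hunn : ∀ t, 0 ≤ t → ∀ x, 0 ≤ u t x
  huL1 : ∀ t, 0 ≤ t → Integrable (u t)
  hloc : ∀ T : ℝ, 0 < T → ∃ C : ℝ, ∀ t ∈ Set.Icc (0 : ℝ) T,
      eLpNorm (u t) (ENNReal.ofReal p) volume ≤ ENNReal.ofReal C ∧ (∫ x, u t x) ≤ C
  hCw : ∀ Φ : E2 → ℝ, Continuous Φ → HasCompactSupport Φ →
      Continuous fun t => ∫ x, Φ x * u t x
  hξC1 : ContDiff ℝ 1 ξ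
  hE : ∀ Φ : ℝ → E2 → ℝ,
      ContDiff ℝ (⊤ : ℕ∞) (fun q : ℝ × E2 => Φ q.1 q.2) →
      HasCompactSupport (fun q : ℝ × E2 => Φ q.1 q.2) →
      ∀ t, 0 ≤ t →
        (∫ x, Φ t x ∂(mu (u t) γ (ξ t))) - (∫ x, Φ 0 x ∂(mu (u 0) γ (ξ 0))) =
        ∫ s in (0 : ℝ)..t,
          ((∫ x, deriv (fun τ => Φ τ x) s ∂(mu (u s) γ (ξ s))) +
            Hform (Φ s) (mu (u s) γ (ξ s)) (mu (u s) γ (ξ s)))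

namespace Sys

variable {γ p : ℝ} {u : ℝ → E2 → ℝ} {ξ : ℝ → E2}

theorem um (S : Sys γ p u ξ) (t : ℝ) : Measurable (u t) :=
  S.humeas.comp measurable_prodMk_left

theorem good (S : Sys γ p u ξ) (T : ℝ) (hT : 0 < T) :
    ∃ M : ℝ, 0 ≤ M ∧ ∀ t ∈ Set.Icc 0 T, Good (u t) M := by
  obtain ⟨C, hC⟩ := S.hloc T hT
  obtain ⟨M, hM, H⟩ := good_of p C S.hp
  exact ⟨M, hM, fun t ht => H _ (S.um t) (S.hunn t ht.1) (S.huL1 t ht.1) (hC t ht).1 (hC t ht).2⟩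

theorem near (S : Sys γ p u ξ) (T : ℝ) (hT : 0 < T) (η : ℝ) (hη : 0 < η) :
    ∃ r : ℝ, 0 < r ∧ r ≤ 1 ∧ ∀ t ∈ Set.Icc 0 T, ∀ x,
      ∫ y in Metric.ball x r, u t y * ‖x - y‖⁻¹ ≤ η := by
  obtain ⟨C, hC⟩ := S.hloc T hT
  obtain ⟨r, hr, hr1, H⟩ := near_small p C η S.hp hη
  exact ⟨r, hr, hr1, fun t ht => H _ (S.um t) (S.hunn t ht.1) (hC t ht).1⟩

end Sys

/-- The weak transport expression. -/
def Bt (γ : ℝ) (u : ℝ → E2 → ℝ) (ξ : ℝ → E2) (Φ : ℝ → E2 → ℝ) (s : ℝ) : ℝ :=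
  ∫ x, (deriv (fun τ => Φ τ x) s +
    ⟪Ep (u s) x + γ • Kv (x - ξ s), gradient (Φ s) x⟫) * u s x

/-- The contribution at the point mass. -/
def Pt (u : ℝ → E2 → ℝ) (ξ : ℝ → E2) (Φ : ℝ → E2 → ℝ) (s : ℝ) : ℝ :=
  deriv (fun τ => Φ τ (ξ s)) s + ⟪Ep (u s) (ξ s), gradient (Φ s) (ξ s)⟫

namespace Sys

variable {γ p : ℝ} {u : ℝ → E2 → ℝ} {ξ : ℝ → E2} {Φ : ℝ → E2 → ℝ}

theorem measurable_E (S : Sys γ p u ξ) : Measurable fun q : ℝ × E2 => Ep (u q.1) q.2 := by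
  have h1 : Measurable fun r : (ℝ × E2) × E2 => u r.1.1 r.2 :=
    S.humeas.comp (measurable_fst.fst.prodMk measurable_snd)
  have h2 : Measurable fun r : (ℝ × E2) × E2 => Kv (r.1.2 - r.2) :=
    measurable_Kv.comp (measurable_fst.snd.sub measurable_snd)
  exact (h1.smul h2).stronglyMeasurable.integral_prod_right'.measurable

theorem measurable_Bt (S : Sys γ p u ξ)
    (hs : ContDiff ℝ (⊤ : ℕ∞) (fun q : ℝ × E2 => Φ q.1 q.2)) : Measurable (Bt γ u ξ Φ) := by
  have hK : Measurable fun q : ℝ × E2 => Kv (q.2 - ξ q.1) :=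
    measurable_Kv.comp (measurable_snd.sub (S.hξC1.continuous.measurable.comp measurable_fst))
  have hV : Measurable fun q : ℝ × E2 => Ep (u q.1) q.2 + γ • Kv (q.2 - ξ q.1) :=
    S.measurable_E.add (hK.const_smul γ)
  have : Measurable fun q : ℝ × E2 => (deriv (fun τ => Φ τ q.2) q.1 +
    ⟪Ep (u q.1) q.2 + γ • Kv (q.2 - ξ q.1), gradient (Φ q.1) q.2⟫) * u q.1 q.2 :=
    ((continuous_dt hs).measurable.add (hV.inner (continuous_gradient hs).measurable)).mul S.humeas
  exact this.stronglyMeasurable.integral_prod_right'.measurable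

theorem measurable_Pt (S : Sys γ p u ξ)
    (hs : ContDiff ℝ (⊤ : ℕ∞) (fun q : ℝ × E2 => Φ q.1 q.2)) : Measurable (Pt u ξ Φ) := by
  have h : Measurable fun s => (s, ξ s) := measurable_id.prodMk S.hξC1.continuous.measurable
  exact ((continuous_dt hs).measurable.comp h).add
    ((S.measurable_E.comp h).inner ((continuous_gradient hs).measurable.comp h))

theorem Kint' {f : E2 → ℝ} {M C : ℝ} (g : Good f M) (hγ : 0 < γ) {φ : E2 → ℝ} (a : E2)
    (hc : Continuous (gradient φ)) (hC : ∀ x, ‖gradient φ x‖ ≤ C) :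
    Integrable (fun x => ⟪Ep f x + γ • Kv (x - a), gradient φ x⟫ * f x) ∧
    ∀ x, ‖⟪Ep f x + γ • Kv (x - a), gradient φ x⟫ * f x‖ ≤
      ‖gradient φ x‖ * (M * f x + γ * (f x * ‖a - x‖⁻¹)) := by
  have hb : ∀ x, ‖⟪Ep f x + γ • Kv (x - a), gradient φ x⟫ * f x‖ ≤
      ‖gradient φ x‖ * (M * f x + γ * (f x * ‖a - x‖⁻¹)) := by
    intro x
    rw [norm_mul, Real.norm_of_nonneg (g.nn x)]
    have h1 : ‖Ep f x + γ • Kv (x - a)‖ ≤ M + γ * ‖a - x‖⁻¹ := by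
      refine (norm_add_le _ _).trans (add_le_add (g.Ep_bd x) ?_)
      rw [norm_smul, norm_Kv, Real.norm_of_nonneg hγ.le, norm_sub_rev]
    have h2 := (norm_inner_le_norm (𝕜 := ℝ) (Ep f x + γ • Kv (x - a)) (gradient φ x)).trans
      (mul_le_mul_of_nonneg_right h1 (norm_nonneg _))
    refine (mul_le_mul_of_nonneg_right h2 (g.nn x)).trans (le_of_eq ?_)
    ring
  refine ⟨?_, hb⟩
  have hm : Measurable fun x => ⟪Ep f x + γ • Kv (x - a), gradient φ x⟫ * f x := by
    have hK : Measurable fun x => Kv (x - a) := measurable_Kv.comp (by fun_prop)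
    have hV : Measurable fun x => Ep f x + γ • Kv (x - a) :=
      (measurable_Ep g.meas).measurable.add (hK.const_smul γ)
    exact (hV.inner hc.measurable).mul g.meas
  refine (((g.int.const_mul M).add ((g.kint a).const_mul γ)).const_mul C).mono'
    hm.aestronglyMeasurable (Eventually.of_forall fun x => (hb x).trans ?_)
  refine mul_le_mul_of_nonneg_right (hC x) ?_
  have hM : 0 ≤ M := (norm_nonneg _).trans (g.Ep_bd 0)
  have := g.nn x
  positivity

theorem formula (S : Sys γ p u ξ)
    (hs : ContDiff ℝ (⊤ : ℕ∞) (fun q : ℝ × E2 => Φ q.1 q.2))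
    (hc : HasCompactSupport (fun q : ℝ × E2 => Φ q.1 q.2)) (t : ℝ) (ht : 0 ≤ t) :
    ((∫ x, Φ t x * u t x) + γ * Φ t (ξ t)) - ((∫ x, Φ 0 x * u 0 x) + γ * Φ 0 (ξ 0)) =
      ∫ s in (0 : ℝ)..t, (Bt γ u ξ Φ s + γ * Pt u ξ Φ s) := by
  obtain ⟨M, hM, hg⟩ := S.good (t + 1) (by linarith)
  obtain ⟨C, hC0, hC1, hC2, hC3⟩ := bounds_test hs hc
  have hgc : ∀ s, Continuous (gradient (Φ s)) := fun s =>
    (continuous_gradient hs).comp (by fun_prop : Continuous fun x : E2 => (s, x))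
  have hΦc : ∀ s, Continuous (Φ s) := fun s =>
    hs.continuous.comp (by fun_prop : Continuous fun x : E2 => (s, x))
  have hdc : ∀ s, Continuous fun x => deriv (fun τ => Φ τ x) s := fun s =>
    (continuous_dt hs).comp (by fun_prop : Continuous fun x : E2 => (s, x))
  have hΦi : ∀ s ∈ Set.Icc 0 (t + 1), Integrable fun x => Φ s x * u s x := fun s hs =>
    (hg s hs).int.bdd_mul (hΦc s).aestronglyMeasurable (Eventually.of_forall (hC3 s))
  have hdi : ∀ s ∈ Set.Icc 0 (t + 1), Integrable fun x => deriv (fun τ => Φ τ x) s * u s x :=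
    fun s hs => (hg s hs).int.bdd_mul (hdc s).aestronglyMeasurable (Eventually.of_forall (hC2 s))
  have htI : t ∈ Set.Icc 0 (t + 1) := ⟨ht, by linarith⟩
  have h0I : (0 : ℝ) ∈ Set.Icc 0 (t + 1) := ⟨le_refl _, by linarith⟩
  have key := S.hE Φ hs hc t ht
  rw [integral_mu (hg t htI).meas (hg t htI).nn S.hγ _ (hΦi t htI),
    integral_mu (hg 0 h0I).meas (hg 0 h0I).nn S.hγ _ (hΦi 0 h0I)] at key
  rw [key]
  refine intervalIntegral.integral_congr fun s hsI => ?_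
  rw [Set.uIcc_of_le ht] at hsI
  have hsI' : s ∈ Set.Icc 0 (t + 1) := ⟨hsI.1, by linarith [hsI.2]⟩
  have g := hg s hsI'
  rw [integral_mu g.meas g.nn S.hγ _ (hdi s hsI'), Hform_eq g S.hγ _ (hgc s) (hC1 s)]
  have e : Bt γ u ξ Φ s = (∫ x, deriv (fun τ => Φ τ x) s * u s x) +
      ∫ x, ⟪Ep (u s) x + γ • Kv (x - ξ s), gradient (Φ s) x⟫ * u s x := by
    rw [← integral_add (hdi s hsI') (Kint' g S.hγ (ξ s) (hgc s) (hC1 s)).1, Bt]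
    congr 1; ext x; ring
  rw [e, Pt]; ring

theorem integrable_Bt (S : Sys γ p u ξ)
    (hs : ContDiff ℝ (⊤ : ℕ∞) (fun q : ℝ × E2 => Φ q.1 q.2))
    (hc : HasCompactSupport (fun q : ℝ × E2 => Φ q.1 q.2)) (a b : ℝ) (ha : 0 ≤ a) (hb : 0 ≤ b) :
    IntervalIntegrable (Bt γ u ξ Φ) volume a b := by
  have hT : 0 < max a b + 1 := by have := le_max_left a b; linarith
  obtain ⟨M, hM, hg⟩ := S.good (max a b + 1) hT
  obtain ⟨C, hC0, hC1, hC2, hC3⟩ := bounds_test hs hc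
  have hgc : ∀ s, Continuous (gradient (Φ s)) := fun s =>
    (continuous_gradient hs).comp (by fun_prop : Continuous fun x : E2 => (s, x))
  refine (intervalIntegrable_const (c := C * M + C * (M * M + γ * M))).mono_fun'
    (S.measurable_Bt hs).aestronglyMeasurable ?_
  filter_upwards [ae_restrict_mem measurableSet_uIoc] with s hsI
  have hsI' : s ∈ Set.Icc 0 (max a b + 1) := by
    rw [Set.uIoc, Set.mem_Ioc] at hsI
    exact ⟨(le_min ha hb).trans hsI.1.le, by linarith [hsI.2]⟩
  have g := hg s hsI'
  have hi : Integrable fun x => C * u s x + C * (M * u s x + γ * (u s x * ‖ξ s - x‖⁻¹)) :=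
    (g.int.const_mul C).add
      (((g.int.const_mul M).add ((g.kint (ξ s)).const_mul γ)).const_mul C)
  refine (norm_integral_le_of_norm_le hi (Eventually.of_forall fun x => ?_)).trans ?_
  · rw [add_mul]
    refine (norm_add_le _ _).trans (add_le_add ?_ ?_)
    · rw [norm_mul, Real.norm_of_nonneg (g.nn x)]
      exact mul_le_mul_of_nonneg_right (hC2 s x) (g.nn x)
    · refine ((Kint' g S.hγ (ξ s) (hgc s) (hC1 s)).2 x).trans
        (mul_le_mul_of_nonneg_right (hC1 s x) ?_)
      have := g.nn x
      have := S.hγ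
      positivity
  · have i1 : Integrable fun x => M * u s x := g.int.const_mul M
    have i2 : Integrable fun x => γ * (u s x * ‖ξ s - x‖⁻¹) := (g.kint (ξ s)).const_mul γ
    have i3 : Integrable fun x => M * u s x + γ * (u s x * ‖ξ s - x‖⁻¹) := i1.add i2
    rw [integral_add (g.int.const_mul C) (i3.const_mul C), integral_const_mul, integral_const_mul,
      integral_add i1 i2, integral_const_mul, integral_const_mul]
    have := g.mass
    have := g.kbd (ξ s)
    have := S.hγ
    gcongr

theorem integrable_Pt (S : Sys γ p u ξ)
    (hs : ContDiff ℝ (⊤ : ℕ∞) (fun q : ℝ × E2 => Φ q.1 q.2))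
    (hc : HasCompactSupport (fun q : ℝ × E2 => Φ q.1 q.2)) (a b : ℝ) (ha : 0 ≤ a) (hb : 0 ≤ b) :
    IntervalIntegrable (Pt u ξ Φ) volume a b := by
  have hT : 0 < max a b + 1 := by have := le_max_left a b; linarith
  obtain ⟨M, hM, hg⟩ := S.good (max a b + 1) hT
  obtain ⟨C, hC0, hC1, hC2, hC3⟩ := bounds_test hs hc
  refine (intervalIntegrable_const (c := C + M * C)).mono_fun'
    (S.measurable_Pt hs).aestronglyMeasurable ?_
  filter_upwards [ae_restrict_mem measurableSet_uIoc] with s hsI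
  have hsI' : s ∈ Set.Icc 0 (max a b + 1) := by
    rw [Set.uIoc, Set.mem_Ioc] at hsI
    exact ⟨(le_min ha hb).trans hsI.1.le, by linarith [hsI.2]⟩
  have g := hg s hsI'
  refine (norm_add_le _ _).trans (add_le_add (hC2 s _) ?_)
  refine (norm_inner_le_norm (𝕜 := ℝ) _ _).trans ?_
  exact mul_le_mul (g.Ep_bd _) (hC1 s _) (norm_nonneg _) hM

end Sys


/-- A continuous, compactly supported truncation of the kernel. -/
def Kc (R : ℝ) (z : E2) : E2 := (max 0 (((max ‖z‖ R⁻¹) ^ 2)⁻¹ - (R ^ 2)⁻¹)) • perp z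

theorem continuous_Kc (R : ℝ) (hR : 1 ≤ R) : Continuous (Kc R) := by
  have h0 : 0 < R⁻¹ := by positivity
  have h1 : Continuous fun z : E2 => ((max ‖z‖ R⁻¹) ^ 2)⁻¹ := by
    refine Continuous.inv₀ (by fun_prop) fun z => ?_
    have : 0 < max ‖z‖ R⁻¹ := lt_max_of_lt_right h0
    positivity
  have h2 : Continuous fun z : E2 => perp z := perpL.continuous
  exact (continuous_const.max (h1.sub continuous_const)).smul h2

theorem Kc_zero (R : ℝ) (hR : 1 ≤ R) (z : E2) (hz : R < ‖z‖) : Kc R z = 0 := by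
  have h1 : max ‖z‖ R⁻¹ = ‖z‖ := max_eq_left ((inv_le_one_of_one_le₀ hR).trans (hR.trans hz.le))
  have h2 : (‖z‖ ^ 2)⁻¹ ≤ (R ^ 2)⁻¹ := by
    apply inv_anti₀ (by positivity)
    gcongr
  rw [Kc, h1, max_eq_left (by linarith), zero_smul]

theorem Kc_diff (R : ℝ) (hR : 1 ≤ R) (z : E2) :
    ‖Kv z - Kc R z‖ ≤ R⁻¹ + (Metric.ball (0 : E2) R⁻¹).indicator (fun z => ‖z‖⁻¹) z := by
  have hR0 : 0 < R := by linarith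
  have h0 : 0 < R⁻¹ := by positivity
  by_cases hz : z = 0
  · subst hz
    have h1 : 0 ≤ (Metric.ball (0 : E2) R⁻¹).indicator (fun z => ‖z‖⁻¹) 0 :=
      Set.indicator_nonneg (fun z _ => by positivity) _
    have h2 : ‖Kv 0 - Kc R 0‖ = 0 := by simp [Kv, Kc, ← perpL_apply]
    rw [h2]
    linarith
  have hzp : 0 < ‖z‖ := norm_pos_iff.2 hz
  have e : ‖Kv z - Kc R z‖ =
      |(‖z‖ ^ 2)⁻¹ - max 0 (((max ‖z‖ R⁻¹) ^ 2)⁻¹ - (R ^ 2)⁻¹)| * ‖z‖ := by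
    rw [Kv, Kc, ← sub_smul, norm_smul, norm_perp, Real.norm_eq_abs]
  rw [e]
  by_cases hb : ‖z‖ < R⁻¹
  · have hm : z ∈ Metric.ball (0 : E2) R⁻¹ := by simpa using hb
    rw [Set.indicator_of_mem hm, max_eq_right hb.le]
    have h1 : (R⁻¹ ^ 2)⁻¹ ≤ (‖z‖ ^ 2)⁻¹ := by
      apply inv_anti₀ (by positivity)
      gcongr
    have h2 : 0 ≤ (R ^ 2)⁻¹ := by positivity
    have h3 : 0 ≤ (‖z‖ ^ 2)⁻¹ := by positivity
    have h4 : |(‖z‖ ^ 2)⁻¹ - max 0 ((R⁻¹ ^ 2)⁻¹ - (R ^ 2)⁻¹)| ≤ (‖z‖ ^ 2)⁻¹ := by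
      rw [abs_le]
      constructor
      · have : max 0 ((R⁻¹ ^ 2)⁻¹ - (R ^ 2)⁻¹) ≤ (‖z‖ ^ 2)⁻¹ := max_le h3 (by linarith)
        linarith
      · have := le_max_left 0 ((R⁻¹ ^ 2)⁻¹ - (R ^ 2)⁻¹)
        linarith
    have h5 : (‖z‖ ^ 2)⁻¹ * ‖z‖ = ‖z‖⁻¹ := by field_simp
    have := mul_le_mul_of_nonneg_right h4 hzp.le
    linarith
  · have hm : z ∉ Metric.ball (0 : E2) R⁻¹ := by simpa using hb
    rw [Set.indicator_of_notMem hm, max_eq_left (not_lt.1 hb), add_zero]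
    by_cases hzR : ‖z‖ ≤ R
    · have h2 : (R ^ 2)⁻¹ ≤ (‖z‖ ^ 2)⁻¹ := by
        apply inv_anti₀ (by positivity)
        gcongr
      rw [max_eq_right (by linarith), sub_sub_cancel, abs_of_nonneg (by positivity)]
      calc (R ^ 2)⁻¹ * ‖z‖ ≤ (R ^ 2)⁻¹ * R := by gcongr
        _ = R⁻¹ := by field_simp
    · have hzR' : R ≤ ‖z‖ := (not_le.1 hzR).le
      have h2 : (‖z‖ ^ 2)⁻¹ ≤ (R ^ 2)⁻¹ := by
        apply inv_anti₀ (by positivity)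
        gcongr
      rw [max_eq_left (by linarith), sub_zero, abs_of_nonneg (by positivity)]
      calc (‖z‖ ^ 2)⁻¹ * ‖z‖ = ‖z‖⁻¹ := by field_simp
        _ ≤ R⁻¹ := inv_anti₀ hR0 hzR'

namespace Sys

variable {γ p : ℝ} {u : ℝ → E2 → ℝ} {ξ : ℝ → E2}

theorem cont_trunc (S : Sys γ p u ξ) (T : ℝ) (hT : 0 < T) (κ : E2 → ℝ) (hκ : Continuous κ)
    (hκc : HasCompactSupport κ) :
    ContinuousOn (fun s => ∫ y, κ (ξ s - y) * u s y) (Set.Icc 0 T) := by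
  obtain ⟨M, hM, hg⟩ := S.good T hT
  have huc : UniformContinuous κ := hκc.uniformContinuous_of_continuous hκ
  obtain ⟨B, hB⟩ := hκ.bounded_above_of_compact_support hκc
  have hint : ∀ x, ∀ s ∈ Set.Icc 0 T, Integrable fun y => κ (x - y) * u s y := fun x s hs =>
    (hg s hs).int.bdd_mul (hκ.comp (by fun_prop : Continuous fun y => x - y)).aestronglyMeasurable
      (Eventually.of_forall fun y => hB (x - y))
  intro t ht
  have hcg : Continuous fun s => ∫ y, κ (ξ t - y) * u s y := by
    refine S.hCw (fun y => κ (ξ t - y)) (hκ.comp (by fun_prop)) ?_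
    exact hκc.comp_homeomorph (Homeomorph.subLeft (ξ t))
  rw [Metric.continuousWithinAt_iff]
  intro ε hε
  obtain ⟨δ, hδ, H⟩ := Metric.uniformContinuous_iff.1 huc (ε / (2 * (M + 1))) (by positivity)
  obtain ⟨δ1, hδ1, H1⟩ := Metric.continuous_iff.1 hcg t (ε / 2) (by positivity)
  obtain ⟨δ2, hδ2, H2⟩ := Metric.continuous_iff.1 S.hξC1.continuous t δ hδ
  refine ⟨min δ1 δ2, lt_min hδ1 hδ2, ?_⟩
  intro s hs hd
  have h1 := H1 s (hd.trans_le (min_le_left _ _))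
  have h2 := H2 s (hd.trans_le (min_le_right _ _))
  have h3 : dist (∫ y, κ (ξ s - y) * u s y) (∫ y, κ (ξ t - y) * u s y) ≤ ε / 2 := by
    rw [dist_eq_norm, ← integral_sub (hint _ s hs) (hint _ s hs)]
    refine (norm_integral_le_of_norm_le ((hg s hs).int.const_mul (ε / (2 * (M + 1))))
      (Eventually.of_forall fun y => ?_)).trans ?_
    · rw [← sub_mul, norm_mul, Real.norm_of_nonneg ((hg s hs).nn y)]
      refine mul_le_mul_of_nonneg_right ?_ ((hg s hs).nn y)
      rw [← dist_eq_norm]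
      refine (H ?_).le
      simpa using h2
    · rw [integral_const_mul]
      calc ε / (2 * (M + 1)) * ∫ y, u s y ≤ ε / (2 * (M + 1)) * (M + 1) := by
            gcongr
            linarith [(hg s hs).mass]
        _ = ε / 2 := by field_simp
  calc _ ≤ dist (∫ y, κ (ξ s - y) * u s y) (∫ y, κ (ξ t - y) * u s y) +
        dist (∫ y, κ (ξ t - y) * u s y) (∫ y, κ (ξ t - y) * u t y) := dist_triangle _ _ _
    _ < ε := by linarith

theorem cont_F (S : Sys γ p u ξ) (T : ℝ) (hT : 0 < T) (e : E2) :
    ContinuousOn (fun s => ⟪Ep (u s) (ξ s), e⟫) (Set.Icc 0 T) := by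
  obtain ⟨M, hM, hg⟩ := S.good T hT
  refine continuousOn_of_uniform_approx_of_continuousOn fun U hU => ?_
  obtain ⟨ε, hε, hεU⟩ := Metric.mem_uniformity_dist.1 hU
  set η : ℝ := ε / (2 * (‖e‖ + 1)) with hη
  have hη0 : 0 < η := by positivity
  obtain ⟨r, hr0, hr1, hr⟩ := S.near T hT η hη0
  set R : ℝ := max (r⁻¹) ((M + 1) / (η / 2)) with hRdef
  have hR1 : 1 ≤ R := (one_le_inv₀ hr0 |>.2 hr1).trans (le_max_left _ _)
  have hRr : R⁻¹ ≤ r := by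
    rw [inv_le_comm₀ (by positivity) hr0]; exact le_max_left _ _
  have hRM : R⁻¹ * M ≤ η / 2 := by
    have : (M + 1) / (η / 2) ≤ R := le_max_right _ _
    rw [div_le_iff₀ (by positivity)] at this
    rw [inv_mul_le_iff₀ (by positivity)]
    linarith
  set κ : E2 → ℝ := fun z => ⟪Kc R z, e⟫ with hκ
  have hκ1 : Continuous κ := (continuous_Kc R hR1).inner continuous_const
  have hκ2 : HasCompactSupport κ := by
    refine HasCompactSupport.intro (isCompact_closedBall (0 : E2) R) fun z hz => ?_
    have : R < ‖z‖ := by simpa using hz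
    simp [hκ, Kc_zero R hR1 z this]
  refine ⟨fun s => ∫ y, κ (ξ s - y) * u s y, S.cont_trunc T hT κ hκ1 hκ2, ?_⟩
  intro s hs
  have g := hg s hs
  refine hεU ?_
  obtain ⟨B, hB⟩ := hκ1.bounded_above_of_compact_support hκ2
  have hint : Integrable fun y => κ (ξ s - y) * u s y :=
    g.int.bdd_mul (hκ1.comp (by fun_prop : Continuous fun y => ξ s - y)).aestronglyMeasurable
      (Eventually.of_forall fun y => hB (ξ s - y))
  have hE : ⟪Ep (u s) (ξ s), e⟫ = ∫ y, ⟪Kv (ξ s - y), e⟫ * u s y := by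
    rw [real_inner_comm, Ep, ← integral_inner (g.Kint (ξ s))]
    congr 1; ext y
    rw [real_inner_smul_right, real_inner_comm, mul_comm]
  have hi1 : Integrable fun y => ⟪Kv (ξ s - y), e⟫ * u s y := by
    have := (g.Kint (ξ s)).const_inner (𝕜 := ℝ) e
    refine this.congr (Eventually.of_forall fun y => ?_)
    simp only
    rw [real_inner_smul_right, real_inner_comm, mul_comm]
  have hbi : IntegrableOn (fun y => u s y * ‖ξ s - y‖⁻¹) (Metric.ball (ξ s) r) :=
    (g.kint (ξ s)).integrableOn
  have hbi' := hbi.integrable_indicator measurableSet_ball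
  have hdom : Integrable fun y => ‖e‖ * (R⁻¹ * u s y +
      (Metric.ball (ξ s) r).indicator (fun y => u s y * ‖ξ s - y‖⁻¹) y) :=
    ((g.int.const_mul R⁻¹).add hbi').const_mul ‖e‖
  rw [dist_eq_norm, hE, ← integral_sub hi1 hint]
  refine (norm_integral_le_of_norm_le hdom (Eventually.of_forall fun y => ?_)).trans_lt ?_
  · rw [← sub_mul, norm_mul, Real.norm_of_nonneg (g.nn y), hκ]
    simp only
    rw [← inner_sub_left]
    have h1 := (norm_inner_le_norm (𝕜 := ℝ) (Kv (ξ s - y) - Kc R (ξ s - y)) e).trans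
      (mul_le_mul_of_nonneg_right (Kc_diff R hR1 (ξ s - y)) (norm_nonneg e))
    refine (mul_le_mul_of_nonneg_right h1 (g.nn y)).trans ?_
    have h2 : (Metric.ball (0 : E2) R⁻¹).indicator (fun z => ‖z‖⁻¹) (ξ s - y) * u s y ≤
        (Metric.ball (ξ s) r).indicator (fun y => u s y * ‖ξ s - y‖⁻¹) y := by
      have hn := g.nn y
      by_cases hb : ξ s - y ∈ Metric.ball (0 : E2) R⁻¹
      · have hb' : y ∈ Metric.ball (ξ s) r := by
          rw [Metric.mem_ball, dist_comm, dist_eq_norm]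
          rw [mem_ball_zero_iff] at hb
          linarith
        rw [Set.indicator_of_mem hb, Set.indicator_of_mem hb']
        rw [mul_comm]
      · rw [Set.indicator_of_notMem hb, zero_mul]
        apply Set.indicator_nonneg
        intro z _
        have := g.nn z
        positivity
    calc (R⁻¹ + (Metric.ball (0 : E2) R⁻¹).indicator (fun z => ‖z‖⁻¹) (ξ s - y)) * ‖e‖ * u s y
        = ‖e‖ * (R⁻¹ * u s y +
          (Metric.ball (0 : E2) R⁻¹).indicator (fun z => ‖z‖⁻¹) (ξ s - y) * u s y) := by ring
      _ ≤ _ := by gcongr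
  · rw [integral_const_mul, integral_add (g.int.const_mul R⁻¹) hbi',
      integral_const_mul, integral_indicator measurableSet_ball]
    have h1 := hr s hs (ξ s)
    have h2 : R⁻¹ * ∫ y, u s y ≤ R⁻¹ * M := by
      gcongr
      exact g.mass
    have h3 : ‖e‖ * (R⁻¹ * (∫ y, u s y) + ∫ y in Metric.ball (ξ s) r, u s y * ‖ξ s - y‖⁻¹)
        ≤ ‖e‖ * (2 * η) := by
      gcongr
      linarith
    refine h3.trans_lt ?_
    have : ε = η * (2 * (‖e‖ + 1)) := by rw [hη]; field_simp
    rw [this]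
    nlinarith [norm_nonneg e]

end Sys


theorem exists_test (e : E2) : ∃ C : ℝ, 0 ≤ C ∧ ∀ (x0 : E2) (ε : ℝ), 0 < ε → ∃ φ : E2 → ℝ,
    ContDiff ℝ (⊤ : ℕ∞) φ ∧ HasCompactSupport φ ∧ (∀ x, ‖gradient φ x‖ ≤ C) ∧
    (∀ x, |φ x| ≤ C * ε) ∧ (∀ x, 2 * ε < ‖x - x0‖ → φ x = 0 ∧ gradient φ x = 0) ∧
    (∀ x, ‖x - x0‖ < ε → φ x = ⟪x - x0, e⟫ ∧ gradient φ x = e) := by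
  set χ : ContDiffBump (0 : E2) := ⟨1, 2, one_pos, one_lt_two⟩ with hχ
  set ψ : E2 → ℝ := fun z => χ z * ⟪z, e⟫ with hψ
  have hψs : ContDiff ℝ (⊤ : ℕ∞) ψ := χ.contDiff.mul (contDiff_id.inner ℝ contDiff_const)
  have hψc : HasCompactSupport ψ := χ.hasCompactSupport.mul_right
  have hd : Continuous (fderiv ℝ ψ) := hψs.continuous_fderiv (by simp)
  obtain ⟨C1, hC1⟩ := hd.bounded_above_of_compact_support (hψc.fderiv (𝕜 := ℝ))
  obtain ⟨C2, hC2⟩ := hψs.continuous.bounded_above_of_compact_support hψc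
  refine ⟨max C1 C2, ((norm_nonneg _).trans (hC1 0)).trans (le_max_left _ _), ?_⟩
  intro x0 ε hε
  set φ : E2 → ℝ := fun x => ε * ψ (ε⁻¹ • (x - x0)) with hφ
  have hφs : ContDiff ℝ (⊤ : ℕ∞) φ :=
    contDiff_const.mul (hψs.comp ((contDiff_id.sub contDiff_const).const_smul ε⁻¹))
  have hout : ∀ x, 2 * ε < ‖x - x0‖ → φ x = 0 := by
    intro x hx
    have : χ (ε⁻¹ • (x - x0)) = 0 := by
      apply χ.zero_of_le_dist
      rw [dist_zero_right, norm_smul, norm_inv, Real.norm_of_nonneg hε.le, le_inv_mul_iff₀ hε]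
      simp only [hχ]
      linarith
    simp only [hφ, hψ, this, zero_mul, mul_zero]
  have hin : ∀ x, ‖x - x0‖ < ε → φ x = ⟪x - x0, e⟫ := by
    intro x hx
    have : χ (ε⁻¹ • (x - x0)) = 1 := by
      apply χ.one_of_mem_closedBall
      rw [mem_closedBall_zero_iff, norm_smul, norm_inv, Real.norm_of_nonneg hε.le,
        inv_mul_le_iff₀ hε]
      simp only [hχ]
      linarith
    simp only [hφ, hψ, this, one_mul, real_inner_smul_left]
    field_simp
  have hder : ∀ x, fderiv ℝ φ x = fderiv ℝ ψ (ε⁻¹ • (x - x0)) := by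
    intro x
    have h1 : HasFDerivAt (fun x : E2 => ε⁻¹ • (x - x0)) (ε⁻¹ • ContinuousLinearMap.id ℝ E2) x :=
      ((hasFDerivAt_id x).sub_const x0).const_smul ε⁻¹
    have h2 : HasFDerivAt ψ (fderiv ℝ ψ (ε⁻¹ • (x - x0))) (ε⁻¹ • (x - x0)) :=
      (hψs.differentiable (by simp) _).hasFDerivAt
    have h3 := (h2.comp x h1).const_mul ε
    refine h3.fderiv.trans ?_
    ext v
    simp
    field_simp
  refine ⟨φ, hφs, ?_, ?_, ?_, ?_, ?_⟩
  · refine HasCompactSupport.intro (isCompact_closedBall x0 (2 * ε)) fun x hx => hout x ?_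
    simpa [dist_eq_norm] using hx
  · intro x
    rw [gradient, LinearIsometryEquiv.norm_map, hder]
    exact (hC1 _).trans (le_max_left _ _)
  · intro x
    simp only [hφ]
    rw [abs_mul, abs_of_pos hε, mul_comm]
    exact mul_le_mul_of_nonneg_right ((hC2 _).trans (le_max_right _ _)) hε.le
  · intro x hx
    refine ⟨hout x hx, ?_⟩
    have : φ =ᶠ[𝓝 x] fun _ => 0 := by
      have : ∀ᶠ y in 𝓝 x, 2 * ε < ‖y - x0‖ :=
        (by fun_prop : Continuous fun y : E2 => ‖y - x0‖).continuousAt.eventually (lt_mem_nhds hx)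
      filter_upwards [this] with y hy using hout y hy
    rw [gradient, this.fderiv_eq]
    simp
  · intro x hx
    refine ⟨hin x hx, ?_⟩
    have : φ =ᶠ[𝓝 x] fun y => ⟪y - x0, e⟫ := by
      have : ∀ᶠ y in 𝓝 x, ‖y - x0‖ < ε :=
        (by fun_prop : Continuous fun y : E2 => ‖y - x0‖).continuousAt.eventually (gt_mem_nhds hx)
      filter_upwards [this] with y hy using hin y hy
    have h4 : HasFDerivAt (fun y : E2 => ⟪y - x0, e⟫) (innerSL ℝ e) x := by
      have h5 := (innerSL ℝ e).hasFDerivAt (x := x - x0)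
      have h6 := h5.comp x ((hasFDerivAt_id x).sub_const x0)
      refine h6.congr_of_eventuallyEq (Eventually.of_forall fun y => ?_)
      simp [real_inner_comm]
    rw [gradient, this.fderiv_eq, h4.fderiv]
    exact (InnerProductSpace.toDual ℝ E2).symm_apply_apply e

namespace Sys

variable {γ p : ℝ} {u : ℝ → E2 → ℝ} {ξ : ℝ → E2}

/-- Integral of a function controlled near a point. -/
theorem near_bound {f : E2 → ℝ} {M η r A B : ℝ} (g : Good f M) (c : E2)
    (hr1 : r ≤ 1) (hA : 0 ≤ A) (hB : 0 ≤ B)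
    (hη : ∫ y in Metric.ball c r, f y * ‖c - y‖⁻¹ ≤ η) (G : E2 → ℝ)
    (h0 : ∀ x, x ∉ Metric.ball c r → G x = 0)
    (h1 : ∀ x, |G x| ≤ A * f x + B * (f x * ‖c - x‖⁻¹)) :
    |∫ x, G x| ≤ (A + B) * η := by
  have hbi := (g.kint c).integrableOn (s := Metric.ball c r)
  have hbi' := (hbi.integrable_indicator measurableSet_ball).const_mul (A + B)
  have := norm_integral_le_of_norm_le (f := G) hbi' ?_
  · rw [integral_const_mul, integral_indicator measurableSet_ball] at this
    exact this.trans (mul_le_mul_of_nonneg_left hη (by positivity))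
  · have hne : ∀ᵐ x : E2, x ≠ c := by
      simp [ae_iff, measure_singleton]
    filter_upwards [hne] with x hx
    by_cases hb : x ∈ Metric.ball c r
    · rw [Set.indicator_of_mem hb]
      refine (h1 x).trans ?_
      have hpos : 0 < ‖c - x‖ := norm_pos_iff.2 (sub_ne_zero.2 hx.symm)
      have hlt : ‖c - x‖ ≤ 1 := by
        rw [Metric.mem_ball, dist_comm, dist_eq_norm] at hb
        linarith
      have h2 : 1 ≤ ‖c - x‖⁻¹ := (one_le_inv₀ hpos).2 hlt
      have h3 : f x ≤ f x * ‖c - x‖⁻¹ := le_mul_of_one_le_right (g.nn x) h2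
      have h4 := mul_le_mul_of_nonneg_left h3 hA
      linarith
    · rw [Set.indicator_of_notMem hb, h0 x hb]
      simp

theorem key_est (S : Sys γ p u ξ) (e : E2) (a : ℝ) (ha : 0 ≤ a) :
    ∃ C M : ℝ, 0 ≤ C ∧ 0 ≤ M ∧ ∀ η > 0, ∃ r > 0, ∀ h ε : ℝ, 0 < h → h ≤ 1 → 0 < ε → 3 * ε ≤ r →
      (∀ s ∈ Set.Icc a (a + h), ‖ξ s - ξ a‖ < ε) →
      |γ * ⟪ξ (a + h) - ξ a, e⟫ - γ * ∫ s in a..(a + h), ⟪Ep (u s) (ξ s), e⟫| ≤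
        2 * (C * ε * η) + C * (M + γ) * η * h := by
  have hT : 0 < a + 1 := by linarith
  obtain ⟨M, hM, hg⟩ := S.good (a + 1) hT
  obtain ⟨C, hC, htest⟩ := exists_test e
  refine ⟨C, M, hC, hM, ?_⟩
  intro η hη
  obtain ⟨r, hr0, hr1, hr⟩ := S.near (a + 1) hT η hη
  refine ⟨r, hr0, ?_⟩
  intro h ε hh hh1 hε h3 hξ
  obtain ⟨φ, hφs, hφc, hφ1, hφ2, hφ3, hφ4⟩ := htest (ξ a) ε hε
  set θ : ContDiffBump (0 : ℝ) := ⟨a + 2, a + 3, by linarith, by linarith⟩ with hθ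
  set Φ : ℝ → E2 → ℝ := fun t x => θ t * φ x with hΦ
  have hs : ContDiff ℝ (⊤ : ℕ∞) (fun q : ℝ × E2 => Φ q.1 q.2) :=
    (θ.contDiff.comp contDiff_fst).mul (hφs.comp contDiff_snd)
  have hc : HasCompactSupport (fun q : ℝ × E2 => Φ q.1 q.2) := by
    refine HasCompactSupport.intro (θ.hasCompactSupport.isCompact.prod hφc.isCompact) fun q hq => ?_
    simp only [hΦ]
    by_contra hne
    refine hq ⟨subset_tsupport _ ?_, subset_tsupport _ ?_⟩
    · exact left_ne_zero_of_mul hne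
    · exact right_ne_zero_of_mul hne
  have hθ1 : ∀ s ∈ Set.Icc 0 (a + 1), θ =ᶠ[𝓝 s] 1 := by
    intro s hsI
    apply θ.eventuallyEq_one_of_mem_ball
    rw [mem_ball_zero_iff, Real.norm_of_nonneg hsI.1]
    simp only [hθ]
    linarith [hsI.2]
  have hΦs : ∀ s ∈ Set.Icc 0 (a + 1), Φ s = φ := by
    intro s hsI
    ext x
    simp only [hΦ, (hθ1 s hsI).eq_of_nhds, Pi.one_apply, one_mul]
  have hΦd : ∀ s ∈ Set.Icc 0 (a + 1), ∀ x, deriv (fun τ => Φ τ x) s = 0 := by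
    intro s hsI x
    have : (fun τ => Φ τ x) =ᶠ[𝓝 s] fun _ => φ x := by
      filter_upwards [hθ1 s hsI] with τ hτ
      simp only [hΦ, hτ, Pi.one_apply, one_mul]
    rw [this.deriv_eq]
    simp
  have hsub : ∀ s ∈ Set.Icc a (a + h), s ∈ Set.Icc 0 (a + 1) := fun s hs =>
    ⟨ha.trans hs.1, by linarith [hs.2]⟩
  have haI : a ∈ Set.Icc a (a + h) := ⟨le_refl _, by linarith⟩
  have hbI : a + h ∈ Set.Icc a (a + h) := ⟨by linarith, le_refl _⟩
  have hBi := S.integrable_Bt hs hc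
  have hPi := S.integrable_Pt hs hc
  have f1 := S.formula hs hc (a + h) (by linarith)
  have f2 := S.formula hs hc a ha
  have f3 := intervalIntegral.integral_add_adjacent_intervals
    (((hBi 0 a le_rfl ha).add ((hPi 0 a le_rfl ha).const_mul γ)))
    (((hBi a (a + h) ha (by linarith)).add ((hPi a (a + h) ha (by linarith)).const_mul γ)))
  have f4 := intervalIntegral.integral_add (hBi a (a + h) ha (by linarith))
    ((hPi a (a + h) ha (by linarith)).const_mul γ)
  rw [intervalIntegral.integral_const_mul] at f4
  have f5 : ∫ s in a..(a + h), Pt u ξ Φ s = ∫ s in a..(a + h), ⟪Ep (u s) (ξ s), e⟫ := by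
    refine intervalIntegral.integral_congr fun s hsI => ?_
    rw [Set.uIcc_of_le (by linarith)] at hsI
    simp only [Pt]
    rw [hΦd s (hsub s hsI), hΦs s (hsub s hsI), (hφ4 _ (hξ s hsI)).2, zero_add]
  rw [hΦs _ (hsub _ hbI), (hφ4 _ (hξ _ hbI)).1] at f1
  rw [hΦs _ (hsub _ haI), (hφ4 _ (hξ _ haI)).1, sub_self, inner_zero_left, mul_zero, add_zero] at f2
  have hball : ∀ s ∈ Set.Icc a (a + h), ∀ x, x ∉ Metric.ball (ξ s) r → 2 * ε < ‖x - ξ a‖ := by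
    intro s hsI x hx
    have h5 := hξ s hsI
    rw [Metric.mem_ball, not_lt, dist_eq_norm] at hx
    have h6 : ‖x - ξ s‖ ≤ ‖x - ξ a‖ + ‖ξ s - ξ a‖ := by
      have := norm_sub_le (x - ξ a) (ξ s - ξ a)
      simpa using this
    linarith
  have b1 : ∀ s ∈ Set.Icc a (a + h), |∫ x, φ x * u s x| ≤ C * ε * η := by
    intro s hsI
    have g := hg s (hsub s hsI)
    have := near_bound (A := C * ε) (B := 0) g (ξ s) hr1 (by positivity) le_rfl
      (hr s (hsub s hsI) (ξ s)) (fun x => φ x * u s x) ?_ ?_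
    · simpa using this
    · intro x hx
      simp only [(hφ3 x (hball s hsI x hx)).1, zero_mul]
    · intro x
      rw [zero_mul, add_zero, abs_mul, abs_of_nonneg (g.nn x)]
      exact mul_le_mul_of_nonneg_right (hφ2 x) (g.nn x)
  have hgc : Continuous (gradient φ) :=
    (InnerProductSpace.toDual ℝ E2).symm.continuous.comp (hφs.continuous_fderiv (by simp))
  have b2 : ∀ s ∈ Set.Icc a (a + h), |Bt γ u ξ Φ s| ≤ C * (M + γ) * η := by
    intro s hsI
    have g := hg s (hsub s hsI)
    have hγ := S.hγ
    have := near_bound (A := C * M) (B := C * γ) g (ξ s) hr1 (by positivity) (by positivity)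
      (hr s (hsub s hsI) (ξ s))
      (fun x => ⟪Ep (u s) x + γ • Kv (x - ξ s), gradient φ x⟫ * u s x) ?_ ?_
    · rw [Bt]
      simp_rw [hΦd s (hsub s hsI), hΦs s (hsub s hsI), zero_add]
      refine this.trans (le_of_eq ?_)
      ring
    · intro x hx
      simp only [(hφ3 x (hball s hsI x hx)).2, inner_zero_right, zero_mul]
    · intro x
      refine ((Kint' g hγ (ξ s) hgc hφ1).2 x).trans ?_
      have := g.nn x
      calc _ ≤ C * (M * u s x + γ * (u s x * ‖ξ s - x‖⁻¹)) := by
            refine mul_le_mul_of_nonneg_right (hφ1 x) (by positivity)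
        _ = _ := by ring
  have b3 : |∫ s in a..(a + h), Bt γ u ξ Φ s| ≤ C * (M + γ) * η * h := by
    have := intervalIntegral.norm_integral_le_of_norm_le_const (a := a) (b := a + h)
      (f := Bt γ u ξ Φ) (C := C * (M + γ) * η) ?_
    · rw [add_sub_cancel_left, abs_of_pos hh] at this
      exact this
    · intro s hsI
      rw [Set.uIoc_of_le (by linarith)] at hsI
      exact b2 s ⟨hsI.1.le, hsI.2⟩
  have e1 : γ * ⟪ξ (a + h) - ξ a, e⟫ - γ * ∫ s in a..(a + h), ⟪Ep (u s) (ξ s), e⟫ =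
      (∫ s in a..(a + h), Bt γ u ξ Φ s) - (∫ x, φ x * u (a + h) x) + ∫ x, φ x * u a x := by
    rw [← f5]
    linarith
  rw [e1]
  have c1 := b1 _ haI
  have c2 := b1 _ hbI
  rw [abs_le] at c1 c2 b3 ⊢
  constructor <;> linarith [c1.1, c1.2, c2.1, c2.2, b3.1, b3.2]

theorem ode_inner (S : Sys γ p u ξ) (e : E2) (a : ℝ) (ha : 0 ≤ a) :
    ⟪deriv ξ a, e⟫ = ⟪Ep (u a) (ξ a), e⟫ := by
  have hξd : HasDerivAt ξ (deriv ξ a) a := (S.hξC1.differentiable (by simp) a).hasDerivAt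
  set F : ℝ → ℝ := fun s => ⟪Ep (u s) (ξ s), e⟫ with hF
  have hFc := S.cont_F (a + 1) (by linarith) e
  have hT : Set.Icc a (a + 1) ⊆ Set.Icc 0 (a + 1) := Set.Icc_subset_Icc_left ha
  have hFi : ContinuousWithinAt F (Set.Ioi a) a := by
    have h1 : ContinuousWithinAt F (Set.Icc a (a + 1)) a :=
      (hFc.mono hT) a ⟨le_rfl, by linarith⟩
    have h2 : ContinuousWithinAt F (Set.Ici a) a := by
      refine h1.mono_of_mem_nhdsWithin ?_
      exact Icc_mem_nhdsGE (by linarith)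
    exact h2.mono Set.Ioi_subset_Ici_self
  have hFm : Measurable F := by
    have h : Measurable fun s => (s, ξ s) := measurable_id.prodMk S.hξC1.continuous.measurable
    exact (S.measurable_E.comp h).inner measurable_const
  have d1 : HasDerivWithinAt (fun t => ∫ s in a..t, F s) (F a) (Set.Ici a) a :=
    intervalIntegral.integral_hasDerivWithinAt_right (by simp)
      (hFm.stronglyMeasurable.stronglyMeasurableAtFilter) hFi
  have d2 : HasDerivWithinAt (fun t => ⟪ξ t, e⟫) ⟪deriv ξ a, e⟫ (Set.Ici a) a := by
    have := (hξd.inner ℝ (hasDerivAt_const a e)).hasDerivWithinAt (s := Set.Ici a)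
    simpa using this
  have d3 := d2.sub d1
  have d4 : HasDerivWithinAt ((fun t => ⟪ξ t, e⟫) - fun t => ∫ s in a..t, F s) 0 (Set.Ici a) a := by
    rw [hasDerivWithinAt_iff_isLittleO, Asymptotics.isLittleO_iff]
    intro c hc
    obtain ⟨C, M, hC, hM, H⟩ := S.key_est e a ha
    obtain ⟨L, hL⟩ := hξd.isBigO_sub.bound
    have hγ := S.hγ
    set L' : ℝ := |L| + 1 with hL'
    have hL'0 : 0 < L' := by positivity
    set Q : ℝ := 2 * C * L' + C * (M + γ) + 1 with hQ
    have hQ0 : 0 < Q := by positivity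
    obtain ⟨r, hr, Hr⟩ := H (γ * c / Q) (by positivity)
    obtain ⟨δ, hδ, Hδ⟩ := Metric.eventually_nhds_iff.1 hL
    have ev : ∀ᶠ t in 𝓝[Set.Ici a] a, t < a + min (min 1 δ) (r / (3 * L')) := by
      apply mem_nhdsWithin_of_mem_nhds
      apply Iio_mem_nhds
      have : 0 < min (min 1 δ) (r / (3 * L')) := by positivity
      linarith
    filter_upwards [ev, self_mem_nhdsWithin] with t ht hat
    rcases eq_or_lt_of_le (Set.mem_Ici.1 hat) with heq | hlt
    · rw [← heq]; simp
    set h : ℝ := t - a with hh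
    have hht : t = a + h := by rw [hh]; ring
    have hpos : 0 < h := by rw [hh]; linarith
    have hmin : h < min (min 1 δ) (r / (3 * L')) := by rw [hh]; linarith
    have hm1 : h < 1 := hmin.trans_le ((min_le_left _ _).trans (min_le_left _ _))
    have hm2 : h < δ := hmin.trans_le ((min_le_left _ _).trans (min_le_right _ _))
    have hm3 : h < r / (3 * L') := hmin.trans_le (min_le_right _ _)
    rw [lt_div_iff₀ (by positivity)] at hm3
    have key := Hr h (L' * h) hpos hm1.le (by positivity) (by linarith) ?_
    · have e1 : ((fun t => ⟪ξ t, e⟫) - fun t => ∫ s in a..t, F s) t -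
          ((fun t => ⟪ξ t, e⟫) - fun t => ∫ s in a..t, F s) a - (h • (0 : ℝ)) =
          ⟪ξ (a + h) - ξ a, e⟫ - ∫ s in a..(a + h), F s := by
        simp only [Pi.sub_apply, hht, inner_sub_left, intervalIntegral.integral_same, smul_zero]
        ring
      rw [e1, Real.norm_eq_abs, Real.norm_of_nonneg hpos.le]
      rw [← mul_sub, abs_mul, abs_of_pos hγ] at key
      have e2 : 2 * (C * (L' * h) * (γ * c / Q)) + C * (M + γ) * (γ * c / Q) * h =
          γ * (c * h * ((2 * C * L' + C * (M + γ)) / Q)) := by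
        field_simp
      rw [e2] at key
      have key2 := le_of_mul_le_mul_left key hγ
      refine key2.trans ?_
      have : (2 * C * L' + C * (M + γ)) / Q ≤ 1 := by
        rw [div_le_one hQ0]; linarith
      exact mul_le_of_le_one_right (by positivity) this
    · intro s hs
      have hd : dist s a ≤ h := by
        rw [Real.dist_eq, abs_of_nonneg (by linarith [hs.1])]
        linarith [hs.2]
      have h1 := Hδ (hd.trans_lt hm2)
      rw [← dist_eq_norm s a] at h1
      have h2 : L * dist s a ≤ |L| * h := mul_le_mul (le_abs_self L) hd dist_nonneg (abs_nonneg L)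
      have h3 : |L| * h < L' * h := by
        rw [hL']; linarith
      linarith
  have hu := (uniqueDiffWithinAt_Ici a).eq_deriv _ d3 d4
  simp only [hF] at hu
  linarith

theorem ode (S : Sys γ p u ξ) (a : ℝ) (ha : 0 ≤ a) : deriv ξ a = Ep (u a) (ξ a) :=
  ext_inner_right ℝ fun e => S.ode_inner e a ha

theorem transport (S : Sys γ p u ξ) {Φ : ℝ → E2 → ℝ}
    (hs : ContDiff ℝ (⊤ : ℕ∞) (fun q : ℝ × E2 => Φ q.1 q.2))
    (hc : HasCompactSupport (fun q : ℝ × E2 => Φ q.1 q.2))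
    (h0 : ∀ t : ℝ, t ≤ 0 → ∀ x, Φ t x = 0) :
    ∫ t in Set.Ioi (0 : ℝ), Bt γ u ξ Φ t = 0 := by
  obtain ⟨R, hR0, hR⟩ := hc.isCompact.isBounded.exists_pos_norm_lt
  have hz : ∀ t, R ≤ t → ∀ x, Φ t x = 0 := by
    intro t ht x
    by_contra hne
    have h1 := hR (t, x) (subset_tsupport _ hne)
    have h2 : ‖t‖ ≤ ‖(t, x)‖ := norm_fst_le (t, x)
    have h3 : t ≤ ‖t‖ := le_abs_self t
    linarith
  have hBz : ∀ t, R + 1 ≤ t → Bt γ u ξ Φ t = 0 := by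
    intro t ht
    have hg : Φ t = fun _ => 0 := by ext x; exact hz t (by linarith) x
    have hd : ∀ x, deriv (fun τ => Φ τ x) t = 0 := by
      intro x
      have : (fun τ => Φ τ x) =ᶠ[𝓝 t] fun _ => 0 := by
        filter_upwards [lt_mem_nhds (by linarith : R < t)] with τ hτ using hz τ hτ.le x
      rw [this.deriv_eq]; simp
    have hgr : ∀ x, gradient (Φ t) x = 0 := by
      intro x; rw [hg, gradient]; simp
    rw [Bt]
    simp [hd, hgr]
  have hT : 0 ≤ R + 1 := by linarith
  have f := S.formula hs hc (R + 1) hT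
  have hzT : ∀ x, Φ (R + 1) x = 0 := hz _ (by linarith)
  have hz0 : ∀ x, Φ 0 x = 0 := h0 0 le_rfl
  simp only [hzT, hz0, zero_mul, integral_zero, mul_zero, add_zero, sub_zero] at f
  rw [intervalIntegral.integral_add (S.integrable_Bt hs hc 0 _ le_rfl hT)
    ((S.integrable_Pt hs hc 0 _ le_rfl hT).const_mul γ), intervalIntegral.integral_const_mul] at f
  have hP : ∫ s in (0 : ℝ)..(R + 1), Pt u ξ Φ s = 0 := by
    have := intervalIntegral.integral_eq_sub_of_hasDerivAt (a := 0) (b := R + 1)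
      (f := fun s => Φ s (ξ s)) (f' := Pt u ξ Φ) ?_ (S.integrable_Pt hs hc 0 _ le_rfl hT)
    · rw [this, hzT, hz0, sub_zero]
    · intro s hsI
      rw [Set.uIcc_of_le hT] at hsI
      have hξd : HasDerivAt ξ (deriv ξ s) s := (S.hξC1.differentiable (by simp) s).hasDerivAt
      rw [S.ode s hsI.1] at hξd
      exact hasDerivAt_along hs hξd
  rw [hP, mul_zero, add_zero] at f
  rw [intervalIntegral.integral_of_le hT] at f
  rw [setIntegral_eq_of_subset_of_forall_sdiff_eq_zero (s := Set.Ioc 0 (R + 1)) measurableSet_Ioi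
    Set.Ioc_subset_Ioi_self ?_, ← f]
  intro t ht
  apply hBz
  have h1 : 0 < t := ht.1
  by_contra hlt
  exact ht.2 ⟨h1, (not_le.1 hlt).le⟩

end Sys


/-- **Theorem 3 (decoupling into the vortex-wave system).** Let `γ > 0`, `p > 2`,
`ρ(t) = u(t,·)dx ∈ C_w(ℝ₊, M₊(ℝ²)) ∩ L^∞_loc(L¹ ∩ L^p)` and `ξ ∈ C¹(ℝ₊, ℝ²)`. If equation (E)
holds with vanishing defect measure, i.e. for every test function `Φ` and every `t ≥ 0`,
`∫Φ(t)d(ρ(t)+γδ_{ξ(t)}) - ∫Φ(0)d(ρ(0)+γδ_{ξ(0)})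
  = ∫₀ᵗ (∫∂_tΦ d(ρ(s)+γδ_{ξ(s)}) + H_{Φ(s)}[ρ(s)+γδ_{ξ(s)}, ρ(s)+γδ_{ξ(s)}]) ds`,
then `ρ` solves the transport equation
`∂_tρ + (E^⊥ + γ(x-ξ)^⊥/|x-ξ|²)·∇ρ = 0` in `D'((0,∞)×ℝ²)` and `ξ̇(t) = E^⊥(t,ξ(t))`,
where `E(t,·) = (x/|x|²) ∗ ρ(t)`. -/
theorem stmt2 (γ p : ℝ) (hγ : 0 < γ) (hp : 2 < p)
    (u : ℝ → E2 → ℝ) (ξ : ℝ → E2)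
    (humeas : Measurable (Function.uncurry u))
    (hunn : ∀ t, 0 ≤ t → ∀ x, 0 ≤ u t x)
    (huL1 : ∀ t, 0 ≤ t → Integrable (u t))
    (huLp : ∀ t, 0 ≤ t → MemLp (u t) (ENNReal.ofReal p) volume)
    (hloc : ∀ T : ℝ, 0 < T → ∃ C : ℝ, ∀ t ∈ Set.Icc (0 : ℝ) T,
      eLpNorm (u t) (ENNReal.ofReal p) volume ≤ ENNReal.ofReal C ∧ (∫ x, u t x) ≤ C)
    (hCw : ∀ Φ : E2 → ℝ, Continuous Φ → HasCompactSupport Φ →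
      Continuous fun t => ∫ x, Φ x * u t x)
    (hξC1 : ContDiff ℝ 1 ξ)
    -- equation (E) with vanishing defect measure:
    (hE : ∀ Φ : ℝ → E2 → ℝ,
      ContDiff ℝ (⊤ : ℕ∞) (fun q : ℝ × E2 => Φ q.1 q.2) →
      HasCompactSupport (fun q : ℝ × E2 => Φ q.1 q.2) →
      ∀ t, 0 ≤ t →
        (∫ x, Φ t x ∂((volume.withDensity fun x => ENNReal.ofReal (u t x)) +
            ENNReal.ofReal γ • Measure.dirac (ξ t))) -
          (∫ x, Φ 0 x ∂((volume.withDensity fun x => ENNReal.ofReal (u 0 x)) +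
            ENNReal.ofReal γ • Measure.dirac (ξ 0))) =
        ∫ s in (0 : ℝ)..t,
          ((∫ x, deriv (fun τ => Φ τ x) s
              ∂((volume.withDensity fun x => ENNReal.ofReal (u s x)) +
                ENNReal.ofReal γ • Measure.dirac (ξ s))) +
            Hform (Φ s)
              ((volume.withDensity fun x => ENNReal.ofReal (u s x)) +
                ENNReal.ofReal γ • Measure.dirac (ξ s))
              ((volume.withDensity fun x => ENNReal.ofReal (u s x)) +
                ENNReal.ofReal γ • Measure.dirac (ξ s)))) :
    -- (i) the transport equation in D'((0,∞)×ℝ²):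
    (∀ Φ : ℝ → E2 → ℝ,
      ContDiff ℝ (⊤ : ℕ∞) (fun q : ℝ × E2 => Φ q.1 q.2) →
      HasCompactSupport (fun q : ℝ × E2 => Φ q.1 q.2) →
      (∀ t : ℝ, t ≤ 0 → ∀ x, Φ t x = 0) →
      ∫ t in Set.Ioi (0 : ℝ), ∫ x,
        (deriv (fun τ => Φ τ x) t +
          ⟪perp (∫ y, u t y • ((‖x - y‖ ^ 2)⁻¹ • (x - y))) +
              (γ / ‖x - ξ t‖ ^ 2) • perp (x - ξ t),
            gradient (Φ t) x⟫) * u t x = 0) ∧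
    -- (ii) the ODE for the point charge:
    (∀ t, 0 ≤ t →
      HasDerivAt ξ (perp (∫ y, u t y • ((‖ξ t - y‖ ^ 2)⁻¹ • (ξ t - y)))) t) := by
  have S : Sys γ p u ξ := ⟨hγ, hp, humeas, hunn, huL1, hloc, hCw, hξC1, hE⟩
  refine ⟨fun Φ hs hc h0 => ?_, fun t ht => ?_⟩
  · have key := S.transport hs hc h0
    refine Eq.trans ?_ key
    refine setIntegral_congr_fun (X := ℝ) (s := Set.Ioi (0:ℝ)) (μ := volume) measurableSet_Ioi fun t ht => ?_
    obtain ⟨M, _, hg⟩ := S.good (t + 1) (by have : 0 < t := ht; linarith)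
    have g := hg t ⟨le_of_lt ht, by linarith⟩
    simp only [Bt]
    congr 1
    ext x
    rw [g.Ep_eq x, Kv, smul_smul, div_eq_mul_inv]
  · obtain ⟨M, _, hg⟩ := S.good (t + 1) (by linarith)
    have g := hg t ⟨ht, by linarith⟩
    rw [g.Ep_eq, ← S.ode t ht]
    exact (S.hξC1.differentiable (by simp) t).hasDerivAt
end
end

section
/- (Hölder estimate on the trajectory of the charge, Corollary 2.9, abstract form.) Let T>0, γ>0, C₀>0. For each ε∈(0,1), let ρ_ε:[0,T]→M₊(ℝ²) be a family of bounded positive Radon measures and ξ_ε:[0,T]→ℝ² a map, satisfying: (i) (non-concentration) ρ_ε(t)(B(x₀,r)) ≤ C₀|ln r|^{−1/2} for all t∈[0,T], x₀∈ℝ², 0<r<1/2; (ii) (weak equicontinuity) for every Φ∈C_c^∞(ℝ²) and all 0≤s<t≤T, |∫Φdρ_ε(t)+γΦ(ξ_ε(t))−∫Φdρ_ε(s)−γΦ(ξ_ε(s))| ≤ C₀‖Φ‖_{W^{2,∞}}(t−s)+C₀(1+T)ε‖Φ‖_{W^{3,∞}}. Then there exist K₀>1 and ε₀>0, depending only on T,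 γ and C₀, such that for all 0<ε<ε₀ and all 0≤s<t≤T: |ξ_ε(t)−ξ_ε(s)| ≤ K₀((t−s)^{1/2}+ε^{1/3}). -/
open MeasureTheory Real Filter
open scoped RealInnerProductSpace ENNReal Topology Classical

noncomputable section

/-- `‖Φ‖_{W^{k,∞}}`: the supremum of all derivatives of `Φ` of order `≤ k`. -/
def Wknorm (k : ℕ) (Φ : E2 → ℝ) : ℝ :=
  ⨆ x : E2, ⨆ i : Fin (k + 1), ‖iteratedFDeriv ℝ i Φ x‖

lemma chi_bound (f : ContDiffBump (0 : E2)) :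
    ∃ A : ℝ, 1 ≤ A ∧ ∀ i : ℕ, i ≤ 3 → ∀ x, ‖iteratedFDeriv ℝ i f x‖ ≤ A := by
  have h : ∀ i : ℕ, ∃ C : ℝ, ∀ x, ‖iteratedFDeriv ℝ i f x‖ ≤ C := fun i =>
    (f.hasCompactSupport.iteratedFDeriv i).exists_bound_of_continuous
      ((f.contDiff (n := (i : ℕ∞))).continuous_iteratedFDeriv (by simp))
  choose C hC using h
  refine ⟨1 + ∑ i ∈ Finset.range 4, |C i|, ?_, fun i hi x => ?_⟩
  · have := Finset.sum_nonneg (s := Finset.range 4) (f := fun i => |C i|) (fun i _ => abs_nonneg _)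
    linarith
  · have := Finset.single_le_sum (s := Finset.range 4) (f := fun i => |C i|)
      (fun i _ => abs_nonneg _) (Finset.mem_range.2 (by omega : i < 4))
    have h2 := hC i x
    have h3 := le_abs_self (C i)
    linarith

lemma scaled_bound (f : ContDiffBump (0 : E2)) (A : ℝ) (hA : 1 ≤ A)
    (h : ∀ i : ℕ, i ≤ 3 → ∀ x, ‖iteratedFDeriv ℝ i f x‖ ≤ A) (a : E2) (R : ℝ) (hR : 0 < R)
    (hR1 : R ≤ 1) (k : ℕ) (hk : k ≤ 3) :
    Wknorm k (fun x => f (R⁻¹ • (x - a))) ≤ A * (R⁻¹) ^ k := by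
  have hi1 : 1 ≤ R⁻¹ := (one_le_inv₀ hR).2 hR1
  refine Real.iSup_le (fun x => Real.iSup_le (fun i => ?_) (by positivity)) (by positivity)
  have hik : (i : ℕ) ≤ k := by have := i.2; omega
  let g : E2 →L[ℝ] E2 := R⁻¹ • ContinuousLinearMap.id ℝ E2
  have e1 : iteratedFDeriv ℝ i (fun x => f (R⁻¹ • (x - a))) x
      = iteratedFDeriv ℝ i (f ∘ g) (x - a) := by
    rw [← iteratedFDeriv_comp_sub]
    rfl
  rw [e1, g.iteratedFDeriv_comp_right (f.contDiff (n := (i : ℕ))) _ le_rfl]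
  refine (ContinuousMultilinearMap.norm_compContinuousLinearMap_le _ _).trans ?_
  have hg : ‖g‖ ≤ R⁻¹ := by
    refine (norm_smul_le R⁻¹ (ContinuousLinearMap.id ℝ E2)).trans ?_
    rw [Real.norm_of_nonneg (by positivity)]
    exact mul_le_of_le_one_right (by positivity) ContinuousLinearMap.norm_id_le
  rw [Finset.prod_const, Finset.card_univ, Fintype.card_fin]
  have h1 : ‖g‖ ^ (i : ℕ) ≤ R⁻¹ ^ k :=
    (pow_le_pow_left₀ (norm_nonneg _) hg _).trans (pow_le_pow_right₀ hi1 hik)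
  exact mul_le_mul (h _ (hik.trans hk) _) h1 (by positivity) (by positivity)

lemma key (γ C₀ c R R₀ τ W2 W3 : ℝ) (hγ : 0 < γ) (μ ν : Measure E2) [IsFiniteMeasure μ]
    [IsFiniteMeasure ν] (f : ContDiffBump (0 : E2)) (hf : f.rOut = 1) (a b : E2)
    (hR : 0 < R) (hRR : R ≤ R₀)
    (hμ : (μ (Metric.ball a R₀)).toReal ≤ γ / 4)
    (hab : R ≤ ‖b - a‖)
    (hB : |(∫ x, f (R⁻¹ • (x - a)) ∂μ) + γ * f (R⁻¹ • (b - a)) - (∫ x, f (R⁻¹ • (x - a)) ∂ν)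
      - γ * f (R⁻¹ • (a - a))| ≤ C₀ * W2 * τ + C₀ * c * W3)
    (h2 : C₀ * W2 * τ ≤ γ / 4) (h3 : C₀ * c * W3 ≤ γ / 4) : False := by
  have z : ∀ x : E2, R ≤ ‖x - a‖ → f (R⁻¹ • (x - a)) = 0 := by
    intro x hx
    apply f.zero_of_le_dist
    rw [hf, dist_zero_right, norm_smul, Real.norm_of_nonneg (by positivity), inv_mul_eq_div,
      one_le_div hR]
    exact hx
  have e0 : f (R⁻¹ • (a - a)) = 1 := by
    rw [sub_self, smul_zero]
    exact f.one_of_mem_closedBall (by simp [f.rIn_pos.le])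
  rw [z b hab, e0] at hB
  have n : 0 ≤ ∫ x, f (R⁻¹ • (x - a)) ∂ν := integral_nonneg (fun x => f.nonneg)
  have u : ∫ x, f (R⁻¹ • (x - a)) ∂μ ≤ (μ (Metric.ball a R₀)).toReal := by
    have : (μ (Metric.ball a R₀)).toReal
        = ∫ x, (Metric.ball a R₀).indicator (fun _ => (1 : ℝ)) x ∂μ := by
      rw [integral_indicator Metric.isOpen_ball.measurableSet]
      simp [Measure.real]
    rw [this]
    apply integral_mono_of_nonneg (ae_of_all _ fun x => f.nonneg)
    · exact (integrable_const 1).indicator Metric.isOpen_ball.measurableSet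
    · refine ae_of_all _ fun x => ?_
      by_cases hx : x ∈ Metric.ball a R₀
      · simp only [Set.indicator_of_mem hx]; exact f.le_one
      · simp only [Set.indicator_of_notMem hx]
        rw [z x]
        rw [Metric.mem_ball, dist_eq_norm] at hx
        linarith
  have := (abs_le.1 hB).1
  linarith

lemma R0_exists (γ C₀ : ℝ) (hγ : 0 < γ) (hC₀ : 0 < C₀) :
    ∃ R₀ : ℝ, 0 < R₀ ∧ R₀ < 1 / 2 ∧ C₀ * |Real.log R₀| ^ (-(1 / 2 : ℝ)) ≤ γ / 4 := by
  set B : ℝ := 1 + 4 * C₀ / γ with hB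
  have hB0 : 0 < 4 * C₀ / γ := by positivity
  have hB1 : 1 ≤ B := by linarith
  refine ⟨Real.exp (-(B ^ 2)), Real.exp_pos _, ?_, ?_⟩
  · have h1 : Real.exp (-(B ^ 2)) ≤ Real.exp (-1) := Real.exp_le_exp.2 (by nlinarith)
    have := Real.exp_neg_one_lt_half
    linarith
  · rw [Real.log_exp, abs_neg, abs_of_nonneg (by positivity), ← Real.rpow_natCast,
      ← Real.rpow_mul (by positivity)]
    norm_num
    rw [Real.rpow_neg_one, ← div_eq_mul_inv, div_le_iff₀ (by positivity), hB]
    have : γ / 4 * (1 + 4 * C₀ / γ) = γ / 4 + C₀ := by field_simp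
    linarith

lemma chain (T δ R₀ : ℝ) (hδ : 0 < δ) (hR : 0 ≤ R₀) (ξ : ℝ → E2)
    (h : ∀ s t : ℝ, 0 ≤ s → s < t → t ≤ T → t - s ≤ δ → ‖ξ t - ξ s‖ ≤ R₀) (n : ℕ) :
    ∀ s t : ℝ, 0 ≤ s → s < t → t ≤ T → t - s ≤ n * δ → ‖ξ t - ξ s‖ ≤ n * R₀ := by
  induction n with
  | zero => intro s t h0 h1 h2 h3; norm_num at h3; linarith
  | succ n ih =>
    intro s t h0 h1 h2 h3
    push_cast at h3 ⊢
    by_cases hd : t - s ≤ δ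
    · have := h s t h0 h1 h2 hd
      have : 0 ≤ n * R₀ := by positivity
      linarith
    · push Not at hd
      have a1 := ih s (t - δ) h0 (by linarith) (by linarith) (by linarith)
      have a2 := h (t - δ) t (by linarith) (by linarith) h2 (by linarith)
      have : ξ t - ξ s = (ξ t - ξ (t - δ)) + (ξ (t - δ) - ξ s) := by abel
      rw [this]
      refine (norm_add_le _ _).trans ?_
      linarith

/-- **Corollary 2.9 (Hölder estimate on the trajectory of the charge, abstract form).**
Under the non-concentration bound (i) and the weak equicontinuity bound (ii), there are
`K₀ > 1` and `ε₀ > 0`, depending only on `T`, `γ` and `C₀`, such that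
`|ξ_ε(t) - ξ_ε(s)| ≤ K₀((t-s)^{1/2} + ε^{1/3})` for all `0 < ε < ε₀`, `0 ≤ s < t ≤ T`. -/
theorem stmt7 (T γ C₀ : ℝ) (hT : 0 < T) (hγ : 0 < γ) (hC₀ : 0 < C₀) :
    ∃ K₀ : ℝ, 1 < K₀ ∧ ∃ ε₀ : ℝ, 0 < ε₀ ∧ ε₀ ≤ 1 ∧
      ∀ (ρ : ℝ → ℝ → Measure E2) (ξ : ℝ → ℝ → E2),
        (∀ ε, ε ∈ Set.Ioo (0 : ℝ) 1 → ∀ t ∈ Set.Icc 0 T, IsFiniteMeasure (ρ ε t)) →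
        (∀ ε, ε ∈ Set.Ioo (0 : ℝ) 1 → ∀ t ∈ Set.Icc 0 T, ∀ x₀ : E2, ∀ r : ℝ,
          0 < r → r < 1 / 2 →
          ((ρ ε t) (Metric.ball x₀ r)).toReal ≤ C₀ * |Real.log r| ^ (-(1 / 2 : ℝ))) →
        (∀ ε, ε ∈ Set.Ioo (0 : ℝ) 1 → ∀ Φ : E2 → ℝ, ContDiff ℝ (⊤ : ℕ∞) Φ → HasCompactSupport Φ →
          ∀ s t : ℝ, 0 ≤ s → s < t → t ≤ T →
          |(∫ x, Φ x ∂(ρ ε t)) + γ * Φ (ξ ε t) - (∫ x, Φ x ∂(ρ ε s)) - γ * Φ (ξ ε s)| ≤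
            C₀ * Wknorm 2 Φ * (t - s) + C₀ * (1 + T) * ε * Wknorm 3 Φ) →
        ∀ ε, 0 < ε → ε < ε₀ → ∀ s t : ℝ, 0 ≤ s → s < t → t ≤ T →
          ‖ξ ε t - ξ ε s‖ ≤ K₀ * ((t - s) ^ ((1 : ℝ) / 2) + ε ^ ((1 : ℝ) / 3)) := by
  let f : ContDiffBump (0 : E2) := ⟨1 / 2, 1, by norm_num, by norm_num⟩
  obtain ⟨A, hA, hfA⟩ := chi_bound f
  obtain ⟨R₀, hR₀, hR₀', hlog⟩ := R0_exists γ C₀ hγ hC₀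
  set M : ℝ := 1 + 4 * C₀ * A * (1 + T) / γ with hM
  have hM0 : 0 < 4 * C₀ * A * (1 + T) / γ := by positivity
  have hM1 : 1 ≤ M := by linarith
  have hMγ : C₀ * A * (1 + T) ≤ γ / 4 * M := by
    have : γ / 4 * M = γ / 4 + C₀ * A * (1 + T) := by rw [hM]; field_simp
    linarith
  have hMγ' : C₀ * A ≤ γ / 4 * M := by
    have : C₀ * A * 1 ≤ C₀ * A * (1 + T) := by gcongr; linarith
    linarith
  set q : ℝ := R₀ / (2 * M) with hq
  have hq0 : 0 < q := by positivity
  have hqM : M * (q + q) = R₀ := by rw [hq]; field_simp; norm_num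
  obtain ⟨N, hN⟩ := exists_nat_ge (T / q ^ 2)
  rw [div_le_iff₀ (by positivity)] at hN
  refine ⟨(N + 1) * M + 1, ?_, min 1 (q ^ 3), by positivity, min_le_left _ _, ?_⟩
  · have : 0 < (N + 1 : ℝ) * M := by positivity
    linarith
  intro ρ ξ hfin hconc heq ε hε hε0 s t hs hst htT
  have hε1 : ε < 1 := hε0.trans_le (min_le_left _ _)
  have hεq : ε < q ^ 3 := hε0.trans_le (min_le_right _ _)
  have hεI : ε ∈ Set.Ioo (0 : ℝ) 1 := ⟨hε, hε1⟩
  set e : ℝ := ε ^ ((1 : ℝ) / 3) with he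
  have he0 : 0 < e := by positivity
  have he3 : e ^ 3 = ε := by
    rw [he, ← Real.rpow_natCast, ← Real.rpow_mul hε.le]; norm_num
  have heq' : e ≤ q := by
    by_contra hc
    push Not at hc
    have := pow_lt_pow_left₀ hc hq0.le (n := 3) (by norm_num)
    linarith
  have loc : ∀ s t : ℝ, 0 ≤ s → s < t → t ≤ T → M * ((t - s) ^ ((1 : ℝ) / 2) + e) ≤ R₀ →
      ‖ξ ε t - ξ ε s‖ ≤ M * ((t - s) ^ ((1 : ℝ) / 2) + e) := by
    intro s t hs hst htT hle
    have hτ : 0 < t - s := by linarith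
    set w : ℝ := (t - s) ^ ((1 : ℝ) / 2) with hw
    have hw0 : 0 < w := by positivity
    have hw2 : w ^ 2 = t - s := by
      rw [hw, ← Real.rpow_natCast, ← Real.rpow_mul hτ.le]; norm_num
    by_contra hcon
    push Not at hcon
    set R : ℝ := M * (w + e) with hRdef
    have hR : 0 < R := by positivity
    have hR1 : R ≤ 1 := by linarith
    have := hfin ε hεI t ⟨by linarith, htT⟩
    have := hfin ε hεI s ⟨hs, by linarith⟩
    have cs : ContDiff ℝ (⊤ : ℕ∞) (fun x : E2 => f (R⁻¹ • (x - ξ ε s))) :=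
      f.contDiff.comp (by fun_prop)
    have cc : HasCompactSupport (fun x : E2 => f (R⁻¹ • (x - ξ ε s))) := by
      have hh := f.hasCompactSupport.comp_homeomorph
        ((Homeomorph.subRight (ξ ε s)).trans (Homeomorph.smulOfNeZero R⁻¹ (inv_ne_zero hR.ne')))
      exact hh
    have hB := heq ε hεI _ cs cc s t hs hst htT
    have b2 := scaled_bound f A hA hfA (ξ ε s) R hR hR1 2 (by norm_num)
    have b3 := scaled_bound f A hA hfA (ξ ε s) R hR hR1 3 (by norm_num)
    have hwR : M * w ≤ R := by rw [hRdef]; gcongr; linarith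
    have heR : M * e ≤ R := by rw [hRdef]; gcongr; linarith
    refine key γ C₀ ((1 + T) * ε) R R₀ (t - s)
      (Wknorm 2 (fun x : E2 => f (R⁻¹ • (x - ξ ε s))))
      (Wknorm 3 (fun x : E2 => f (R⁻¹ • (x - ξ ε s)))) hγ (ρ ε t) (ρ ε s) f rfl (ξ ε s) (ξ ε t)
      hR hle ((hconc ε hεI t ⟨by linarith, htT⟩ _ R₀ hR₀ hR₀').trans hlog) hcon.le ?_ ?_ ?_
    · simpa only [mul_assoc] using hB
    · calc _ ≤ C₀ * (A * R⁻¹ ^ 2) * (t - s) := by gcongr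
        _ = C₀ * A * w ^ 2 / R ^ 2 := by rw [hw2]; field_simp
        _ ≤ γ / 4 := by
          rw [div_le_iff₀ (by positivity)]
          calc C₀ * A * w ^ 2 ≤ γ / 4 * M * w ^ 2 := by gcongr
            _ ≤ γ / 4 * M ^ 2 * w ^ 2 := by gcongr; exact le_self_pow₀ hM1 (by norm_num)
            _ = γ / 4 * (M * w) ^ 2 := by ring
            _ ≤ γ / 4 * R ^ 2 := by gcongr
    · calc _ ≤ C₀ * ((1 + T) * ε) * (A * R⁻¹ ^ 3) := by gcongr
        _ = C₀ * A * (1 + T) * e ^ 3 / R ^ 3 := by rw [he3]; field_simp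
        _ ≤ γ / 4 := by
          rw [div_le_iff₀ (by positivity)]
          calc C₀ * A * (1 + T) * e ^ 3 ≤ γ / 4 * M * e ^ 3 := by gcongr
            _ ≤ γ / 4 * M ^ 3 * e ^ 3 := by gcongr; exact le_self_pow₀ hM1 (by norm_num)
            _ = γ / 4 * (M * e) ^ 3 := by ring
            _ ≤ γ / 4 * R ^ 3 := by gcongr
  have step : ∀ s t : ℝ, 0 ≤ s → s < t → t ≤ T → t - s ≤ q ^ 2 → ‖ξ ε t - ξ ε s‖ ≤ R₀ := by
    intro s t hs hst htT hd
    have hh : M * ((t - s) ^ ((1 : ℝ) / 2) + e) ≤ R₀ := by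
      rw [← hqM]
      have : (t - s) ^ ((1 : ℝ) / 2) ≤ q := by
        rw [← Real.sqrt_eq_rpow]
        exact (Real.sqrt_le_left hq0.le).2 hd
      gcongr
    exact (loc s t hs hst htT hh).trans hh
  have hτ : 0 < t - s := by linarith
  have hw0 : 0 < (t - s) ^ ((1 : ℝ) / 2) := by positivity
  set h : ℝ := (t - s) ^ ((1 : ℝ) / 2) + e with hh
  have hh0 : 0 < h := by positivity
  have hNM : 0 ≤ (N : ℝ) * (M * h) := by positivity
  have hMh : 0 ≤ M * h := by positivity
  by_cases hc : M * h ≤ R₀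
  · have := loc s t hs hst htT hc
    nlinarith
  · push Not at hc
    have := chain T (q ^ 2) R₀ (by positivity) hR₀.le (ξ ε) step N s t hs hst htT (by linarith)
    have h2 : (N : ℝ) * R₀ ≤ N * (M * h) := by gcongr
    nlinarith
end
end

section
/- (Bound on the logarithmic interaction energy.) There is a universal constant C>0 such that for every measurable ρ:ℝ²→[0,∞) with ρ∈L¹(ℝ²)∩L²(ℝ²) and ∫_{ℝ²}|x|²ρ(x)dx<∞: ∬_{ℝ²×ℝ²}|ln|x−y||ρ(x)ρ(y)dx dy ≤ C(‖ρ‖_{L¹}‖ρ‖_{L²} + ‖ρ‖_{L¹}^{3/2}(∫_{ℝ²}|x|²ρ(x)dx)^{1/2}). In particular the logarithmic interaction energy ∬ln|x−y|ρ(x)ρ(y)dxdy is absolutely convergent and bounded in absolute value by the same quantity. -/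
open MeasureTheory Real Filter
open scoped RealInnerProductSpace ENNReal Topology Classical

noncomputable section

/-- The local part of the kernel. -/
def gloc (z : E2) : ℝ := if ‖z‖ < 1 then |Real.log ‖z‖| else 0

lemma gloc_nonneg (z : E2) : 0 ≤ gloc z := by
  unfold gloc; split_ifs <;> positivity

lemma gloc_meas : Measurable gloc := by
  unfold gloc
  refine Measurable.ite (measurableSet_lt measurable_norm measurable_const) ?_ measurable_const
  have h : Measurable (fun z : E2 => Real.log ‖z‖) := Real.measurable_log.comp measurable_norm
  exact h.abs

lemma log_bd (z : E2) : |Real.log ‖z‖| ≤ gloc z + ‖z‖ := by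
  unfold gloc
  split_ifs with h
  · linarith [norm_nonneg z]
  · push Not at h
    rw [abs_of_nonneg (Real.log_nonneg h)]
    linarith [Real.log_le_sub_one_of_pos (by linarith : 0 < ‖z‖)]

lemma gloc_sq : Integrable (fun z : E2 => gloc z ^ 2) := by
  have h := (integrable_fun_norm_addHaar (volume : Measure E2)
    (f := fun r : ℝ => if r < 1 then |Real.log r| ^ 2 else 0)).2 ?_
  · refine h.congr (Eventually.of_forall fun z => ?_)
    simp only [gloc]
    split_ifs <;> simp
  · have hd : Module.finrank ℝ E2 = 2 := by simp
    rw [hd]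
    have h0 : IntegrableOn (fun r : ℝ => if r < 1 then (1 : ℝ) else 0) (Set.Ioi 0) := by
      have : (fun r : ℝ => if r < 1 then (1 : ℝ) else 0) = (Set.Iio (1:ℝ)).indicator (fun _ => 1) := by
        ext r; simp [Set.indicator]
      rw [this, IntegrableOn, integrable_indicator_iff measurableSet_Iio, IntegrableOn,
        Measure.restrict_restrict measurableSet_Iio]
      have : Set.Iio (1:ℝ) ∩ Set.Ioi 0 = Set.Ioo 0 1 := by ext; simp [and_comm]
      rw [this]
      exact integrableOn_const (by simp)
    refine Integrable.mono' (h0.const_mul 4) ?_ ?_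
    · apply Measurable.aestronglyMeasurable
      refine Measurable.smul (f := fun y : ℝ => y ^ (2 - 1)) (by fun_prop) ?_
      exact Measurable.ite measurableSet_Iio (by simp only [sq_abs]; exact Real.measurable_log.pow_const 2) measurable_const
    · refine (ae_restrict_iff' measurableSet_Ioi).2 (Eventually.of_forall fun r hr => ?_)
      have hr : 0 < r := hr
      split_ifs with h1
      · have h3 := Real.abs_log_mul_self_rpow_lt r (1/2) hr h1.le (by norm_num)
        have h4 : |Real.log r * r ^ ((1:ℝ)/2)| ^ 2 ≤ 2 ^ 2 := by
          apply pow_le_pow_left₀ (abs_nonneg _)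
          norm_num at h3 ⊢; linarith
        rw [sq_abs, mul_pow, ← Real.sqrt_eq_rpow, Real.sq_sqrt hr.le] at h4
        simp only [smul_eq_mul, sq_abs, Real.norm_eq_abs]
        rw [abs_of_nonneg (by positivity)]
        norm_num at h4 ⊢; linarith
      · simp

lemma cs {f g : E2 → ℝ} (hf0 : ∀ x, 0 ≤ f x) (hg0 : ∀ x, 0 ≤ g x)
    (hf : MemLp f 2 volume) (hg : MemLp g 2 volume) :
    ∫ x, f x * g x ≤ (∫ x, f x ^ 2) ^ ((1:ℝ)/2) * (∫ x, g x ^ 2) ^ ((1:ℝ)/2) := by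
  have := integral_mul_le_Lp_mul_Lq_of_nonneg (μ := (volume : Measure E2)) (p := 2) (q := 2)
    Real.HolderConjugate.two_two (f := f) (g := g) (Eventually.of_forall hf0)
    (Eventually.of_forall hg0) (by simpa using hf) (by simpa using hg)
  simpa using this

/-- **Bound on the logarithmic interaction energy.** For `0 ≤ ρ ∈ L¹ ∩ L²(ℝ²)` with finite second
moment, `∬ |ln|x-y|| ρ(x)ρ(y) dx dy ≤ C(‖ρ‖₁‖ρ‖₂ + ‖ρ‖₁^{3/2}(∫|x|²ρ)^{1/2})`; in particular
the logarithmic interaction energy is absolutely convergent. -/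
theorem stmt15 :
    ∃ C : ℝ, 0 < C ∧ ∀ ρ : E2 → ℝ,
      Measurable ρ → (∀ x, 0 ≤ ρ x) → Integrable ρ → MemLp ρ 2 volume →
      Integrable (fun x => ‖x‖ ^ 2 * ρ x) →
      Integrable (fun q : E2 × E2 => |Real.log ‖q.1 - q.2‖| * ρ q.1 * ρ q.2) ∧
      ∫ q : E2 × E2, |Real.log ‖q.1 - q.2‖| * ρ q.1 * ρ q.2 ≤
        C * ((∫ x, ρ x) * (∫ x, ρ x ^ 2) ^ ((1 : ℝ) / 2) +
          (∫ x, ρ x) ^ ((3 : ℝ) / 2) * (∫ x, ‖x‖ ^ 2 * ρ x) ^ ((1 : ℝ) / 2)) := by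
  set A : ℝ := (∫ z, gloc z ^ 2) ^ ((1:ℝ)/2) with hA
  have hA0 : 0 ≤ A := Real.rpow_nonneg (integral_nonneg fun _ => sq_nonneg _) _
  refine ⟨A + 2, by linarith, fun ρ hm h0 h1 h2 hM => ?_⟩
  set R : ℝ := (∫ x, ρ x ^ 2) ^ ((1 : ℝ) / 2) with hR
  have hR0 : 0 ≤ R := Real.rpow_nonneg (integral_nonneg fun _ => sq_nonneg _) _
  set m : ℝ := ∫ x, ρ x with hmdef
  have hm0 : 0 ≤ m := integral_nonneg h0
  set S : ℝ := (∫ x, ‖x‖ ^ 2 * ρ x) ^ ((1 : ℝ) / 2) with hS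
  have hS0 : 0 ≤ S := Real.rpow_nonneg
    (integral_nonneg fun x => mul_nonneg (sq_nonneg _) (h0 x)) _
  -- local part
  have hgL : MemLp gloc 2 volume :=
    (memLp_two_iff_integrable_sq gloc_meas.aestronglyMeasurable).2 gloc_sq
  have hgx : ∀ x, MemLp (fun y => gloc (x - y)) 2 volume := fun x => by
    refine (memLp_two_iff_integrable_sq
      (gloc_meas.comp (measurable_const.sub measurable_id)).aestronglyMeasurable).2 ?_
    exact gloc_sq.comp_sub_left x
  have hloc_int : ∀ x, Integrable (fun y => gloc (x - y) * ρ y) := fun x => (hgx x).integrable_mul h2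
  have hloc_le : ∀ x, ∫ y, gloc (x - y) * ρ y ≤ A * R := fun x => by
    have := cs (fun y => gloc_nonneg (x - y)) h0 (hgx x) h2
    rwa [integral_sub_left_eq_self (fun z => gloc z ^ 2) volume x] at this
  have hF1m : Measurable (fun q : E2 × E2 => gloc (q.1 - q.2) * ρ q.1 * ρ q.2) :=
    ((gloc_meas.comp (measurable_fst.sub measurable_snd)).mul (hm.comp measurable_fst)).mul
      (hm.comp measurable_snd)
  have hF1n : ∀ q : E2 × E2, 0 ≤ gloc (q.1 - q.2) * ρ q.1 * ρ q.2 := fun q =>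
    mul_nonneg (mul_nonneg (gloc_nonneg _) (h0 _)) (h0 _)
  have hinner : ∀ x, ∫ y, gloc (x - y) * ρ x * ρ y = ρ x * ∫ y, gloc (x - y) * ρ y := fun x => by
    rw [← integral_const_mul]; congr 1; ext y; ring
  have hinner_le : ∀ x, ∫ y, gloc (x - y) * ρ x * ρ y ≤ A * R * ρ x := fun x => by
    rw [hinner, mul_comm]; exact mul_le_mul_of_nonneg_right (hloc_le x) (h0 x)
  have hF1 : Integrable (fun q : E2 × E2 => gloc (q.1 - q.2) * ρ q.1 * ρ q.2) := by
    rw [Measure.volume_eq_prod, integrable_prod_iff hF1m.aestronglyMeasurable]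
    refine ⟨Eventually.of_forall fun x => ?_, ?_⟩
    · refine ((hloc_int x).const_mul (ρ x)).congr (Eventually.of_forall fun y => ?_)
      simp only; ring
    · refine Integrable.mono' (h1.const_mul (A * R)) ?_ (Eventually.of_forall fun x => ?_)
      · exact hF1m.norm.stronglyMeasurable.integral_prod_right'.aestronglyMeasurable
      · rw [Real.norm_of_nonneg (integral_nonneg fun _ => norm_nonneg _)]
        refine le_trans (le_of_eq ?_) (hinner_le x)
        congr 1; ext y
        exact Real.norm_of_nonneg (hF1n (x, y))
  have hF1le : ∫ q : E2 × E2, gloc (q.1 - q.2) * ρ q.1 * ρ q.2 ≤ A * R * m := by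
    have hF1' := hF1
    rw [Measure.volume_eq_prod] at hF1' ⊢
    rw [integral_prod _ hF1', hmdef, ← integral_const_mul]
    exact integral_mono hF1'.integral_prod_left (h1.const_mul _) hinner_le
  -- far part
  have hN : Integrable (fun x : E2 => ‖x‖ * ρ x) := by
    refine Integrable.mono' (h1.add hM) (measurable_norm.mul hm).aestronglyMeasurable
      (Eventually.of_forall fun x => ?_)
    rw [Real.norm_of_nonneg (mul_nonneg (norm_nonneg _) (h0 x))]
    simp only [Pi.add_apply]
    nlinarith [h0 x, mul_nonneg (sq_nonneg (‖x‖ - 1)) (h0 x), mul_nonneg (sq_nonneg ‖x‖) (h0 x)]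
  have hNle : ∫ x : E2, ‖x‖ * ρ x ≤ m ^ ((1:ℝ)/2) * S := by
    have e1 : ∀ x, √(ρ x) ^ 2 = ρ x := fun x => Real.sq_sqrt (h0 x)
    have e2 : ∀ x : E2, (‖x‖ * √(ρ x)) ^ 2 = ‖x‖ ^ 2 * ρ x := fun x => by rw [mul_pow, e1]
    have := cs (f := fun x => √(ρ x)) (g := fun x => ‖x‖ * √(ρ x))
      (fun x => Real.sqrt_nonneg _) (fun x => by positivity)
      ((memLp_two_iff_integrable_sq hm.sqrt.aestronglyMeasurable).2 (by simpa only [e1] using h1))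
      ((memLp_two_iff_integrable_sq (measurable_norm.mul hm.sqrt).aestronglyMeasurable).2
        (by simpa only [Pi.mul_apply, e2] using hM))
    simp only [e1, e2] at this
    refine le_trans (le_of_eq ?_) this
    congr 1; ext x
    rw [mul_left_comm, ← sq, e1]
  have hP1 : Integrable (fun q : E2 × E2 => (‖q.1‖ * ρ q.1) * ρ q.2) := hN.mul_prod h1
  have hP2 : Integrable (fun q : E2 × E2 => ρ q.1 * (‖q.2‖ * ρ q.2)) := h1.mul_prod hN
  have hI1 : ∫ q : E2 × E2, (‖q.1‖ * ρ q.1) * ρ q.2 = (∫ x : E2, ‖x‖ * ρ x) * m :=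
    integral_prod_mul (fun x : E2 => ‖x‖ * ρ x) ρ
  have hI2 : ∫ q : E2 × E2, ρ q.1 * (‖q.2‖ * ρ q.2) = m * (∫ x : E2, ‖x‖ * ρ x) :=
    integral_prod_mul ρ (fun x : E2 => ‖x‖ * ρ x)
  have hpt : ∀ q : E2 × E2, |Real.log ‖q.1 - q.2‖| * ρ q.1 * ρ q.2 ≤
      gloc (q.1 - q.2) * ρ q.1 * ρ q.2 + ((‖q.1‖ * ρ q.1) * ρ q.2 + ρ q.1 * (‖q.2‖ * ρ q.2)) :=
    fun q => by
      have a := log_bd (q.1 - q.2)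
      have b := norm_sub_le q.1 q.2
      have c := mul_nonneg (h0 q.1) (h0 q.2)
      have := mul_le_mul_of_nonneg_right (a.trans (add_le_add_right b _)) c
      linarith
  have hdom := hF1.add (hP1.add hP2)
  have hint : Integrable (fun q : E2 × E2 => |Real.log ‖q.1 - q.2‖| * ρ q.1 * ρ q.2) := by
    refine Integrable.mono' hdom ?_ (Eventually.of_forall fun q => ?_)
    · have h : Measurable (fun q : E2 × E2 => Real.log ‖q.1 - q.2‖) :=
        Real.measurable_log.comp (measurable_fst.sub measurable_snd).norm
      exact ((h.abs.mul (hm.comp measurable_fst)).mul (hm.comp measurable_snd)).aestronglyMeasurable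
    · rw [Real.norm_of_nonneg (mul_nonneg (mul_nonneg (abs_nonneg _) (h0 _)) (h0 _))]
      exact hpt q
  refine ⟨hint, ?_⟩
  have hle := integral_mono hint hdom hpt
  have hsum : ∫ q, ((fun q : E2 × E2 => gloc (q.1 - q.2) * ρ q.1 * ρ q.2) +
      ((fun q : E2 × E2 => (‖q.1‖ * ρ q.1) * ρ q.2) +
        fun q : E2 × E2 => ρ q.1 * (‖q.2‖ * ρ q.2))) q = _ :=
    (integral_add' hF1 (hP1.add hP2)).trans (congrArg _ (integral_add' hP1 hP2))
  rw [hsum, hI1, hI2] at hle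
  have hpow : m ^ ((3:ℝ)/2) = m * m ^ ((1:ℝ)/2) := by
    rw [show (3:ℝ)/2 = 1 + 1/2 by norm_num, Real.rpow_add_of_nonneg hm0 (by norm_num) (by norm_num),
      Real.rpow_one]
  rw [hpow]
  have hp := Real.rpow_nonneg hm0 ((1:ℝ)/2)
  have k1 := mul_le_mul_of_nonneg_left hNle hm0
  have k2 : 0 ≤ m * R := mul_nonneg hm0 hR0
  have k3 : 0 ≤ A * (m * (m ^ ((1:ℝ)/2)) * S) := by positivity
  linarith
end
end
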